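/- arXiv:2601.11470 — 5 statements merged into one kernel-verified Lean document; each statement's English description precedes it below -/
import Mathlib

section
/- Let μ be a Borel probability measure on ℝ^d, let r = (r_k)_{k≥1} be a non-increasing sequence of positive real numbers tending to zero, and let A ⊆ ℝ^d be a non-empty compact set such that sup_{x∈A} ∑_{n=1}^∞ μ(B(x,r_n))² < ∞. If cap_{μ,r}(A) > 0, then ℙ_μ({ω : A ⊆ E_r(ω)}) = 0, i.e. A is ℙ_μ-almost surely not covered by E_r. -/
open MeasureTheory Metric Filter Set
open scoped ENNReal Topology

noncomputable section

variable {d : ℕ}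

/-- The random covering set `E_r(ω) = limsup_n B(ω_n, r_n)` in `ℝ^d`. -/
def coverSet (r : ℕ → ℝ) (ω : ℕ → EuclideanSpace ℝ (Fin d)) : Set (EuclideanSpace ℝ (Fin d)) :=
  ⋂ k, ⋃ n, ⋃ (_ : k ≤ n), ball (ω n) (r n)

/-- The topological support of a measure. -/
def msupport (μ : Measure (EuclideanSpace ℝ (Fin d))) : Set (EuclideanSpace ℝ (Fin d)) :=
  {x | ∀ U : Set (EuclideanSpace ℝ (Fin d)), IsOpen U → x ∈ U → 0 < μ U}

/-- Extended-real exponential. -/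
def expE (a : ℝ≥0∞) : ℝ≥0∞ := if a = ∞ then ∞ else ENNReal.ofReal (Real.exp a.toReal)

/-- The `(μ,r)`-energy of `ν`. -/
def energy (μ : Measure (EuclideanSpace ℝ (Fin d))) (r : ℕ → ℝ)
    (ν : Measure (EuclideanSpace ℝ (Fin d))) : ℝ≥0∞ :=
  ∫⁻ x, (∫⁻ y, expE (∑' n, μ (ball x (r n) ∩ ball y (r n))) ∂ν) ∂ν

/-- The `(μ,r)`-capacity of `A`. -/
def capacity (μ : Measure (EuclideanSpace ℝ (Fin d))) (r : ℕ → ℝ)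
    (A : Set (EuclideanSpace ℝ (Fin d))) : ℝ≥0∞ :=
  sSup {e | ∃ ν : Measure (EuclideanSpace ℝ (Fin d)), IsProbabilityMeasure ν ∧
    IsCompact (msupport ν) ∧ msupport ν ⊆ A ∧ ν (msupport ν)ᶜ = 0 ∧ e = (energy μ r ν)⁻¹}

theorem expE_of_ne_top {a : ℝ≥0∞} (ha : a ≠ ∞) :
    expE a = ENNReal.ofReal (Real.exp a.toReal) := if_neg ha

theorem expE_top : expE ∞ = ∞ := if_pos rfl

theorem expE_zero : expE 0 = 1 := by simp [expE]

theorem expE_ne_top {a : ℝ≥0∞} (ha : a ≠ ∞) : expE a ≠ ∞ := by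
  simp [expE_of_ne_top ha]

theorem expE_ne_zero (a : ℝ≥0∞) : expE a ≠ 0 := by
  by_cases ha : a = ∞
  · simp [ha, expE_top]
  · simp [expE_of_ne_top ha, Real.exp_pos]

theorem expE_add (a b : ℝ≥0∞) : expE (a + b) = expE a * expE b := by
  by_cases ha : a = ∞
  · simp [ha, expE_top, ENNReal.top_mul (expE_ne_zero b)]
  by_cases hb : b = ∞
  · simp [hb, expE_top, ENNReal.mul_top (expE_ne_zero a)]
  rw [expE_of_ne_top ha, expE_of_ne_top hb, expE_of_ne_top (ENNReal.add_ne_top.2 ⟨ha, hb⟩),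
    ENNReal.toReal_add ha hb, Real.exp_add, ENNReal.ofReal_mul (Real.exp_pos _).le]

theorem expE_monotone : Monotone expE := by
  intro a b hab
  by_cases hb : b = ∞
  · simp [hb, expE_top]
  have ha : a ≠ ∞ := ne_top_of_le_ne_top hb hab
  rw [expE_of_ne_top ha, expE_of_ne_top hb]
  exact ENNReal.ofReal_le_ofReal (Real.exp_le_exp.2 (ENNReal.toReal_mono hb hab))

theorem expE_sum {ι : Type*} (s : Finset ι) (f : ι → ℝ≥0∞) :
    expE (∑ i ∈ s, f i) = ∏ i ∈ s, expE (f i) := by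
  classical
  induction s using Finset.induction_on with
  | empty => simp [expE_zero]
  | insert i s hi ih => rw [Finset.sum_insert hi, Finset.prod_insert hi, expE_add, ih]

theorem tendsto_expE_nhds_zero : Tendsto expE (𝓝 0) (𝓝 1) := by
  have h : Tendsto (fun a : ℝ≥0∞ => ENNReal.ofReal (Real.exp a.toReal)) (𝓝 0) (𝓝 1) := by
    have h1 := (ENNReal.continuous_ofReal.comp Real.continuous_exp).continuousAt.tendsto.comp
      (ENNReal.tendsto_toReal ENNReal.zero_ne_top)
    simpa [Function.comp_def] using h1
  refine h.congr' ?_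
  filter_upwards [gt_mem_nhds (ENNReal.zero_lt_top)] with a ha
  exact (expE_of_ne_top ha.ne).symm

/-- The second moment method: the random variable `ω ↦ ∫ f (x, ω) dν(x)` of mean one vanishes with
probability at most its variance. -/
theorem measure_lintegral_eq_zero_add_one_le {X Ω : Type*} [MeasurableSpace X] [MeasurableSpace Ω]
    (P : Measure Ω) [IsProbabilityMeasure P] (ν : Measure X) [IsProbabilityMeasure ν]
    {f : X → Ω → ℝ≥0∞} (hf : Measurable (Function.uncurry f))
    (hmean : ∀ᵐ x ∂ν, ∫⁻ ω, f x ω ∂P = 1) :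
    P {ω | ∫⁻ x, f x ω ∂ν = 0} + 1 ≤ ∫⁻ z, ∫⁻ ω, f z.1 ω * f z.2 ω ∂P ∂(ν.prod ν) := by
  set Z : Ω → ℝ≥0∞ := fun ω => ∫⁻ x, f x ω ∂ν with hZ
  have hZm : Measurable Z := hf.lintegral_prod_left'
  have hfx : ∀ ω, Measurable fun x => f x ω := fun ω => hf.comp measurable_prodMk_right
  have hEZ : ∫⁻ ω, Z ω ∂P = 1 := by
    have hswap : AEMeasurable (Function.uncurry fun ω x => f x ω) (P.prod ν) :=
      (hf.comp measurable_swap).aemeasurable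
    rw [hZ, lintegral_lintegral_swap hswap, lintegral_congr_ae hmean]
    simp
  have hEZ2 : ∫⁻ ω, Z ω ^ 2 ∂P = ∫⁻ z, ∫⁻ ω, f z.1 ω * f z.2 ω ∂P ∂(ν.prod ν) := by
    rw [lintegral_lintegral_swap]
    · refine lintegral_congr fun ω => ?_
      rw [lintegral_prod_mul (hfx ω).aemeasurable (hfx ω).aemeasurable, sq]
    · exact Measurable.aemeasurable <|
        (hf.comp (measurable_fst.fst.prodMk measurable_snd)).mul
          (hf.comp (measurable_fst.snd.prodMk measurable_snd))
  have hS : MeasurableSet {ω | Z ω = 0} := hZm (measurableSet_singleton 0)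
  have hpt : ∀ ω, {ω | Z ω = 0}.indicator 1 ω + 2 * Z ω ≤ 1 + Z ω ^ 2 := by
    intro ω
    by_cases h0 : Z ω = 0
    · simp [indicator, h0]
    by_cases ht : Z ω = ∞
    · simp [ht]
    obtain ⟨t, ht'⟩ : ∃ t : NNReal, (t : ℝ≥0∞) = Z ω := ⟨_, ENNReal.coe_toNNReal ht⟩
    rw [indicator_of_notMem (by exact h0), zero_add, ← ht']
    have : 2 * t ≤ 1 + t ^ 2 := by
      rw [← NNReal.coe_le_coe]; push_cast; nlinarith [sq_nonneg ((t : ℝ) - 1)]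
    exact_mod_cast this
  have hint := lintegral_mono (μ := P) hpt
  rw [lintegral_add_left (measurable_one.indicator hS), lintegral_indicator_one hS,
    lintegral_const_mul _ hZm, hEZ, lintegral_add_left measurable_const, hEZ2,
    lintegral_one, measure_univ, mul_one] at hint
  rw [← one_add_one_eq_two, ← add_assoc, add_comm (1 : ℝ≥0∞)] at hint
  exact (ENNReal.add_le_add_iff_right ENNReal.one_ne_top).1 hint

theorem one_sub_le_mul_exp {a b c : ℝ} (ha : a ≤ 1 / 2) (hb : b ≤ 1 / 2) (hc : 0 ≤ c)
    (hca : c ≤ a) (hcb : c ≤ b) :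
    1 - (a + b - c) ≤ (1 - a) * (1 - b) * Real.exp (c + (4 * a ^ 2 + 4 * b ^ 2)) := by
  have h1 : 1 + (c + (4 * a ^ 2 + 4 * b ^ 2)) ≤ Real.exp (c + (4 * a ^ 2 + 4 * b ^ 2)) := by
    linarith [Real.add_one_le_exp (c + (4 * a ^ 2 + 4 * b ^ 2))]
  have h2 : 1 / 4 ≤ (1 - a) * (1 - b) := by nlinarith
  refine le_trans ?_ (mul_le_mul_of_nonneg_left h1 (by linarith))
  nlinarith [mul_le_mul_of_nonneg_left hca (hc.trans hca),
    mul_le_mul_of_nonneg_left hcb (hc.trans hcb),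
    mul_nonneg (sub_nonneg.2 h2) (add_nonneg (sq_nonneg a) (sq_nonneg b)),
    mul_nonneg (mul_nonneg (hc.trans hca) (hc.trans hcb)) hc,
    mul_nonneg (hc.trans hca) (hc.trans hcb)]

theorem inv_mul_inv_mul_measure_compl_union_le {E : Type*} [MeasurableSpace E] (μ : Measure E)
    [IsProbabilityMeasure μ] {S T : Set E} (hS : MeasurableSet S) (hT : MeasurableSet T)
    (hS2 : μ S ≤ 2⁻¹) (hT2 : μ T ≤ 2⁻¹) :
    (1 - μ S)⁻¹ * (1 - μ T)⁻¹ * μ (Sᶜ ∩ Tᶜ) ≤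
      expE (μ (S ∩ T) + (4 * μ S ^ 2 + 4 * μ T ^ 2)) := by
  have hhalf : ∀ {U : Set E}, μ U ≤ 2⁻¹ → μ.real U ≤ 1 / 2 := fun {U} h => by
    simpa [Measure.real] using ENNReal.toReal_mono (by simp) h
  have hsub : ∀ U : Set E, 1 - μ U = ENNReal.ofReal (1 - μ.real U) := fun U => by
    rw [ENNReal.ofReal_sub _ measureReal_nonneg, ofReal_measureReal, ENNReal.ofReal_one]
  have hpos : ∀ {U : Set E}, μ U ≤ 2⁻¹ → 0 < 1 - μ.real U := fun h => by
    linarith [hhalf h]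
  have hcap : μ (Sᶜ ∩ Tᶜ) = ENNReal.ofReal (1 - (μ.real S + μ.real T - μ.real (S ∩ T))) := by
    rw [← compl_union, ← ofReal_measureReal, probReal_compl_eq_one_sub (hS.union hT)]
    congr 2
    linarith [measureReal_union_add_inter (μ := μ) (s := S) hT]
  have hexp : expE (μ (S ∩ T) + (4 * μ S ^ 2 + 4 * μ T ^ 2)) = ENNReal.ofReal
      (Real.exp (μ.real (S ∩ T) + (4 * μ.real S ^ 2 + 4 * μ.real T ^ 2))) := by
    have h4 : ∀ U : Set E, 4 * μ U ^ 2 ≠ ∞ := fun U =>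
      ENNReal.mul_ne_top (by simp) (ENNReal.pow_ne_top (measure_ne_top _ _))
    have h44 : 4 * μ S ^ 2 + 4 * μ T ^ 2 ≠ ∞ := ENNReal.add_ne_top.2 ⟨h4 S, h4 T⟩
    rw [expE_of_ne_top (ENNReal.add_ne_top.2 ⟨measure_ne_top _ _, h44⟩),
      ENNReal.toReal_add (measure_ne_top _ _) h44, ENNReal.toReal_add (h4 S) (h4 T)]
    simp [Measure.real]
  rw [hsub S, hsub T, hcap, hexp, ← ENNReal.ofReal_inv_of_pos (hpos hS2),
    ← ENNReal.ofReal_inv_of_pos (hpos hT2), ← ENNReal.ofReal_mul (inv_pos.2 (hpos hS2)).le,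
    ← ENNReal.ofReal_mul (mul_pos (inv_pos.2 (hpos hS2)) (inv_pos.2 (hpos hT2))).le]
  refine ENNReal.ofReal_le_ofReal ?_
  rw [← mul_inv, inv_mul_le_iff₀ (mul_pos (hpos hS2) (hpos hT2))]
  exact one_sub_le_mul_exp (hhalf hS2) (hhalf hT2) measureReal_nonneg
    (measureReal_mono inter_subset_left) (measureReal_mono inter_subset_right)

theorem exists_forall_ge_measure_ball_le_half {E : Type*} [PseudoMetricSpace E]
    [MeasurableSpace E] {μ : Measure E} {r : ℕ → ℝ} (hr : Antitone r) {A : Set E}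
    (h : (⨆ x ∈ A, ∑' n, μ (ball x (r n)) ^ 2) < ∞) :
    ∃ N, ∀ n ≥ N, ∀ x ∈ A, μ (ball x (r n)) ≤ 2⁻¹ := by
  set C := ⨆ x ∈ A, ∑' n, μ (ball x (r n)) ^ 2 with hC
  obtain ⟨N, hN⟩ := ENNReal.exists_nat_gt (ENNReal.mul_ne_top (ENNReal.ofNat_ne_top (n := 4)) h.ne)
  refine ⟨N, fun n hn x hx => ?_⟩
  by_contra! hlt
  have h1 : (n + 1 : ℕ) * μ (ball x (r n)) ^ 2 ≤ C := by
    calc (n + 1 : ℕ) * μ (ball x (r n)) ^ 2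
        = ∑ k ∈ Finset.range (n + 1), μ (ball x (r n)) ^ 2 := by simp
      _ ≤ ∑ k ∈ Finset.range (n + 1), μ (ball x (r k)) ^ 2 := by
          refine Finset.sum_le_sum fun k hk => ?_
          have : r n ≤ r k := hr (Nat.lt_succ_iff.1 (Finset.mem_range.1 hk))
          gcongr
      _ ≤ ∑' k, μ (ball x (r k)) ^ 2 := ENNReal.sum_le_tsum _
      _ ≤ C := le_iSup₂ (f := fun x _ => ∑' n, μ (ball x (r n)) ^ 2) x hx
  have h2 : 1 ≤ 4 * μ (ball x (r n)) ^ 2 := by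
    calc (1 : ℝ≥0∞) = (2 * 2⁻¹) ^ 2 := by
          rw [ENNReal.mul_inv_cancel (by simp) (by simp), one_pow]
      _ ≤ (2 * μ (ball x (r n))) ^ 2 := by gcongr
      _ = 4 * μ (ball x (r n)) ^ 2 := by rw [mul_pow]; norm_num
  refine (lt_irrefl (n : ℝ≥0∞)) ?_
  calc (n : ℝ≥0∞) ≤ (n + 1 : ℕ) * 1 := by simp
    _ ≤ (n + 1 : ℕ) * (4 * μ (ball x (r n)) ^ 2) := by gcongr
    _ = 4 * ((n + 1 : ℕ) * μ (ball x (r n)) ^ 2) := by ring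
    _ ≤ 4 * C := by gcongr
    _ < N := hN
    _ ≤ n := by exact_mod_cast hn

section Product

variable {E : Type*} [PseudoMetricSpace E] [SecondCountableTopology E] [MeasurableSpace E]
  [BorelSpace E]

theorem measurable_measure_ball (μ : Measure E) [SFinite μ] (ρ : ℝ) :
    Measurable fun x => μ (ball x ρ) := by
  have hS : MeasurableSet {p : E × E | dist p.2 p.1 < ρ} :=
    (isOpen_lt (by fun_prop) (by fun_prop)).measurableSet
  exact measurable_measure_prodMk_left hS

theorem measurable_measure_ball_inter_ball (μ : Measure E) [SFinite μ] (ρ : ℝ) :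
    Measurable fun z : E × E => μ (ball z.1 ρ ∩ ball z.2 ρ) := by
  have hS : MeasurableSet {p : (E × E) × E | dist p.2 p.1.1 < ρ ∧ dist p.2 p.1.2 < ρ} :=
    (measurableSet_lt (measurable_snd.dist measurable_fst.fst) measurable_const).inter
      (measurableSet_lt (measurable_snd.dist measurable_fst.snd) measurable_const)
  exact measurable_measure_prodMk_left hS

/-- If finitely many independent random balls have measure at most one half when centred in `A`,
the probability that they cover `A` is controlled by a perturbed energy of any probability measure
carried by `A`. -/
theorem measure_subset_iUnion_ball_add_one_le (μ : Measure E) [IsProbabilityMeasure μ]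
    (P : Measure (ℕ → E)) [IsProbabilityMeasure P]
    (hP : ∀ (s : Finset ℕ) (f : ℕ → Set E), (∀ n, MeasurableSet (f n)) →
      P {ω | ∀ n ∈ s, ω n ∈ f n} = ∏ n ∈ s, μ (f n))
    (r : ℕ → ℝ) {A : Set E} (s : Finset ℕ) (hs : ∀ n ∈ s, ∀ x ∈ A, μ (ball x (r n)) ≤ 2⁻¹)
    (ν : Measure E) [IsProbabilityMeasure ν] (hν : ∀ᵐ x ∂ν, x ∈ A) :
    P {ω | A ⊆ ⋃ n ∈ s, ball (ω n) (r n)} + 1 ≤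
      ∫⁻ z, expE (∑ n ∈ s, (μ (ball z.1 (r n) ∩ ball z.2 (r n)) +
        (4 * μ (ball z.1 (r n)) ^ 2 + 4 * μ (ball z.2 (r n)) ^ 2))) ∂(ν.prod ν) := by
  set c : E → ℝ≥0∞ := fun x => ∏ n ∈ s, (1 - μ (ball x (r n)))⁻¹ with hc
  set U : E → Set (ℕ → E) := fun x => {ω | ∀ n ∈ s, ω n ∈ (ball x (r n))ᶜ} with hU
  set f : E → (ℕ → E) → ℝ≥0∞ := fun x => (U x).indicator fun _ => c x with hf
  have hcm : Measurable c := Finset.measurable_prod _ fun n _ =>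
    (measurable_const.sub (measurable_measure_ball μ (r n))).inv
  have hUm : MeasurableSet {p : E × (ℕ → E) | p.2 ∈ U p.1} := by
    have : {p : E × (ℕ → E) | p.2 ∈ U p.1} =
        ⋂ n ∈ s, {p : E × (ℕ → E) | dist (p.2 n) p.1 < r n}ᶜ := by
      ext p; simp [hU]
    rw [this]
    refine Finset.measurableSet_biInter _ fun n _ => ?_
    have hcoord : Measurable fun p : E × (ℕ → E) => p.2 n :=
      (measurable_pi_apply n).comp measurable_snd
    exact (measurableSet_lt (hcoord.dist measurable_fst) measurable_const).compl
  have hUx : ∀ x, MeasurableSet (U x) := fun x =>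
    measurable_prodMk_left (x := x) hUm
  have hfm : Measurable (Function.uncurry f) := by
    have : Function.uncurry f = {p : E × (ℕ → E) | p.2 ∈ U p.1}.indicator fun p => c p.1 := by
      ext ⟨x, ω⟩; simp [hf, indicator]
    rw [this]
    exact (hcm.comp measurable_fst).indicator hUm
  have hmean : ∀ᵐ x ∂ν, ∫⁻ ω, f x ω ∂P = 1 := by
    filter_upwards [hν] with x hx
    simp only [hf]
    rw [lintegral_indicator_const (hUx x), hP s _ fun n => measurableSet_ball.compl, hc,
      ← Finset.prod_mul_distrib]
    refine Finset.prod_eq_one fun n hn => ?_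
    rw [prob_compl_eq_one_sub measurableSet_ball]
    refine ENNReal.inv_mul_cancel ?_ (by simp)
    exact (tsub_pos_of_lt ((hs n hn x hx).trans_lt (by simp))).ne'
  have hcov : {ω | A ⊆ ⋃ n ∈ s, ball (ω n) (r n)} ⊆ {ω | ∫⁻ x, f x ω ∂ν = 0} := by
    intro ω hω
    refine (lintegral_congr_ae ?_).trans lintegral_zero
    filter_upwards [hν] with x hx
    obtain ⟨n, hn, hxn⟩ := mem_iUnion₂.1 (hω hx)
    have hxU : ω ∉ U x := fun h : ∀ n ∈ s, ω n ∈ (ball x (r n))ᶜ =>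
      h n hn (mem_ball_comm.1 hxn)
    exact indicator_of_notMem hxU _
  have hνν : ∀ᵐ z ∂(ν.prod ν), z.1 ∈ A ∧ z.2 ∈ A :=
    (Measure.quasiMeasurePreserving_fst.ae hν).and (Measure.quasiMeasurePreserving_snd.ae hν)
  refine (add_le_add_left (measure_mono hcov) 1).trans
    ((measure_lintegral_eq_zero_add_one_le P ν hfm hmean).trans (lintegral_mono_ae ?_))
  filter_upwards [hνν] with z hz
  have hprod : ∀ ω, f z.1 ω * f z.2 ω =
      {ω | ∀ n ∈ s, ω n ∈ (ball z.1 (r n))ᶜ ∩ (ball z.2 (r n))ᶜ}.indicator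
        (fun _ => c z.1 * c z.2) ω := by
    intro ω
    have : {ω : ℕ → E | ∀ n ∈ s, ω n ∈ (ball z.1 (r n))ᶜ ∩ (ball z.2 (r n))ᶜ} =
        U z.1 ∩ U z.2 := by
      ext ω; simp only [hU, mem_ofPred_eq, mem_inter_iff]; exact forall₂_and
    rw [this, inter_indicator_mul]
  have hmeas : MeasurableSet
      {ω : ℕ → E | ∀ n ∈ s, ω n ∈ (ball z.1 (r n))ᶜ ∩ (ball z.2 (r n))ᶜ} := by
    convert (hUx z.1).inter (hUx z.2) using 1
    ext ω; simp only [hU, mem_ofPred_eq, mem_inter_iff]; exact forall₂_and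
  simp only [hprod]
  rw [lintegral_indicator_const hmeas,
    hP s _ fun n => measurableSet_ball.compl.inter measurableSet_ball.compl, hc,
    ← Finset.prod_mul_distrib, ← Finset.prod_mul_distrib, expE_sum]
  exact Finset.prod_le_prod' fun n hn => inv_mul_inv_mul_measure_compl_union_le μ
    measurableSet_ball measurableSet_ball (hs n hn _ hz.1) (hs n hn _ hz.2)

end Product

theorem tendsto_lintegral_expE_tsum_add {X : Type*} [MeasurableSpace X] (ν : Measure X)
    {h : ℕ → X → ℝ≥0∞} (hm : ∀ n, Measurable (h n))
    (hfin : ∫⁻ x, expE (∑' n, h n x) ∂ν ≠ ∞) :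
    Tendsto (fun N => ∫⁻ x, expE (∑' n, h (n + N) x) ∂ν) atTop (𝓝 (ν univ)) := by
  have hmeas : ∀ N, Measurable fun x => expE (∑' n, h (n + N) x) := fun N =>
    expE_monotone.measurable.comp (Measurable.tsum fun n => hm (n + N))
  rw [← lintegral_one]
  refine tendsto_lintegral_of_dominated_convergence _ hmeas (fun N => ?_) hfin ?_
  · exact Eventually.of_forall fun x => expE_monotone <|
      ENNReal.tsum_comp_le_tsum_of_injective (add_left_injective N) fun n => h n x
  · filter_upwards [ae_lt_top (by simpa using hmeas 0) hfin] with x hx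
    refine tendsto_expE_nhds_zero.comp (ENNReal.tendsto_sum_nat_add (fun n => h n x) ?_)
    intro htop
    simp [htop, expE_top] at hx

theorem exists_energy_ne_top_of_capacity_pos {μ : Measure (EuclideanSpace ℝ (Fin d))} {r : ℕ → ℝ}
    {A : Set (EuclideanSpace ℝ (Fin d))} (hcap : 0 < capacity μ r A) :
    ∃ ν : Measure (EuclideanSpace ℝ (Fin d)), IsProbabilityMeasure ν ∧ (∀ᵐ x ∂ν, x ∈ A) ∧
      energy μ r ν ≠ ∞ := by
  obtain ⟨e, ⟨ν, hν, -, hsub, hnull, rfl⟩, he⟩ := lt_sSup_iff.1 hcap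
  exact ⟨ν, hν, measure_mono_null (compl_subset_compl.2 hsub) hnull, ENNReal.inv_pos.1 he⟩

/-- If the square sums `∑ μ(B(x,r_n))²` are uniformly bounded on a compact set `A` of positive
`(μ,r)`-capacity, then `A` is `ℙ_μ`-a.s. not covered by `E_r`. -/
theorem not_covered_of_capacity_pos
    (μ : Measure (EuclideanSpace ℝ (Fin d))) [IsProbabilityMeasure μ]
    (P : Measure (ℕ → EuclideanSpace ℝ (Fin d)))
    (hP : ∀ (s : Finset ℕ) (f : ℕ → Set (EuclideanSpace ℝ (Fin d))),
      (∀ n, MeasurableSet (f n)) →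
      P {ω | ∀ n ∈ s, ω n ∈ f n} = ∏ n ∈ s, μ (f n))
    (r : ℕ → ℝ) (hmono : Antitone r) (hpos : ∀ n, 0 < r n)
    (hlim : Tendsto r atTop (𝓝 0))
    (A : Set (EuclideanSpace ℝ (Fin d))) (hne : A.Nonempty) (hAc : IsCompact A)
    (hbound : (⨆ x ∈ A, ∑' n, μ (ball x (r n)) ^ 2) < ∞)
    (hcap : 0 < capacity μ r A) :
    P {ω | A ⊆ coverSet r ω} = 0 := by
  have : IsProbabilityMeasure P := ⟨by simpa using hP ∅ (fun _ => ∅) fun _ => MeasurableSet.empty⟩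
  obtain ⟨ν, hν, hνA, hen⟩ := exists_energy_ne_top_of_capacity_pos hcap
  obtain ⟨N₀, hN₀⟩ := exists_forall_ge_measure_ball_le_half hmono hbound
  set C := ⨆ x ∈ A, ∑' n, μ (ball x (r n)) ^ 2
  set h : ℕ → EuclideanSpace ℝ (Fin d) × EuclideanSpace ℝ (Fin d) → ℝ≥0∞ := fun n z =>
    μ (ball z.1 (r n) ∩ ball z.2 (r n)) +
      (4 * μ (ball z.1 (r n)) ^ 2 + 4 * μ (ball z.2 (r n)) ^ 2) with hh
  have hball : ∀ n, Measurable fun x : EuclideanSpace ℝ (Fin d) => 4 * μ (ball x (r n)) ^ 2 :=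
    fun n => ((measurable_measure_ball μ (r n)).pow_const 2).const_mul 4
  have hm : ∀ n, Measurable (h n) := fun n =>
    (measurable_measure_ball_inter_ball μ (r n)).add
      (((hball n).comp measurable_fst).add ((hball n).comp measurable_snd))
  have hmE : Measurable fun z : EuclideanSpace ℝ (Fin d) × EuclideanSpace ℝ (Fin d) =>
      expE (∑' n, μ (ball z.1 (r n) ∩ ball z.2 (r n))) :=
    expE_monotone.measurable.comp
      (Measurable.tsum fun n => measurable_measure_ball_inter_ball μ (r n))
  have hνν : ∀ᵐ z ∂(ν.prod ν), z.1 ∈ A ∧ z.2 ∈ A :=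
    (Measure.quasiMeasurePreserving_fst.ae hνA).and (Measure.quasiMeasurePreserving_snd.ae hνA)
  have hle : ∀ x ∈ A, ∑' n, μ (ball x (r n)) ^ 2 ≤ C := fun x hx =>
    le_iSup₂ (f := fun x _ => ∑' n, μ (ball x (r n)) ^ 2) x hx
  have hfin : ∫⁻ z, expE (∑' n, h n z) ∂(ν.prod ν) ≠ ∞ := by
    have hC : expE (4 * C + 4 * C) ≠ ∞ := expE_ne_top <|
      have h4 := ENNReal.mul_ne_top (ENNReal.ofNat_ne_top (n := 4)) hbound.ne
      ENNReal.add_ne_top.2 ⟨h4, h4⟩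
    refine ne_top_of_le_ne_top (ENNReal.mul_ne_top hen hC) ?_
    rw [energy, ← lintegral_prod _ hmE.aemeasurable, ← lintegral_mul_const _ hmE]
    refine lintegral_mono_ae ?_
    filter_upwards [hνν] with z hz
    rw [← expE_add]
    refine expE_monotone ?_
    simp only [hh, ENNReal.tsum_add, ENNReal.tsum_mul_left]
    gcongr
    · exact hle _ hz.1
    · exact hle _ hz.2
  have hlimit := tendsto_lintegral_expE_tsum_add (ν.prod ν) hm hfin
  rw [measure_univ] at hlimit
  have hkey : ∀ N ≥ N₀, P {ω | A ⊆ coverSet r ω} + 1 ≤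
      ∫⁻ z, expE (∑' n, h (n + N) z) ∂(ν.prod ν) := by
    intro N hN
    have hsub : {ω | A ⊆ coverSet r ω} ⊆
        ⋃ m : ℕ, {ω | A ⊆ ⋃ n ∈ Finset.Ico N (m + N), ball (ω n) (r n)} := by
      intro ω hω
      obtain ⟨t, ht⟩ := hAc.elim_finite_subcover
        (fun n : ℕ => ball (ω (n + N)) (r (n + N))) (fun _ => isOpen_ball) fun x hx => by
          obtain ⟨n, hn, hxn⟩ := mem_iUnion₂.1 (mem_iInter.1 (hω hx) N)
          exact mem_iUnion.2 ⟨n - N, by rwa [Nat.sub_add_cancel hn]⟩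
      obtain ⟨m, hmt⟩ := t.exists_nat_subset_range
      refine mem_iUnion.2 ⟨m, fun x hx => ?_⟩
      obtain ⟨n, hn, hxn⟩ := mem_iUnion₂.1 (ht hx)
      have := Finset.mem_range.1 (hmt hn)
      exact mem_iUnion₂.2 ⟨n + N, Finset.mem_Ico.2 ⟨by omega, by omega⟩, hxn⟩
    have hmonoU : Monotone fun m : ℕ =>
        {ω : ℕ → EuclideanSpace ℝ (Fin d) |
          A ⊆ ⋃ n ∈ Finset.Ico N (m + N), ball (ω n) (r n)} := by
      intro m m' hmm ω hω
      refine Subset.trans hω (biUnion_subset_biUnion_left fun n hn => ?_)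
      have := Finset.mem_Ico.1 hn
      exact Finset.mem_Ico.2 ⟨this.1, by omega⟩
    refine (add_le_add_left (measure_mono hsub) 1).trans ?_
    rw [hmonoU.measure_iUnion, ENNReal.iSup_add]
    refine iSup_le fun m => (measure_subset_iUnion_ball_add_one_le μ P hP r _
      (fun n hn => hN₀ n (hN.trans (Finset.mem_Ico.1 hn).1)) ν hνA).trans
      (lintegral_mono fun z => expE_monotone ?_)
    rw [Finset.sum_Ico_eq_sum_range]
    simp only [Nat.add_sub_cancel, add_comm N]
    exact ENNReal.sum_le_tsum (f := fun n => h (n + N) z) _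
  have hlast := ge_of_tendsto hlimit (eventually_atTop.2 ⟨N₀, hkey⟩)
  have : P {ω | A ⊆ coverSet r ω} + 1 ≤ 0 + 1 := by simpa using hlast
  exact nonpos_iff_eq_zero.1 ((ENNReal.add_le_add_iff_right ENNReal.one_ne_top).1 this)

end
end

section
/- Let μ be a Borel probability measure on ℝ^d, let r = (r_k)_{k≥1} be a non-increasing sequence of positive real numbers tending to zero with sup_{x∈X} μ(B(x,r_1)) < 1, and let A ⊆ ℝ^d be a non-empty compact set. If there exists a Borel probability measure ν supported in A such that the sequence of second moments (𝔼_{ℙ_μ}(M_{k,ν}²))_{k≥1} is bounded, then ℙ_μ({ω : A ⊆ E_r(ω)}) = 0, i.e. A is ℙ_μ-almost surely not covered by E_r. -/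
open MeasureTheory Metric Filter Set
open scoped ENNReal Topology

noncomputable section

variable {d : ℕ}

/-- The martingale `M_{k,ν}(ω) = ∫ ∏_{n=1}^k (1 - 1_{B(ω_n,r_n)}(x))/(1 - μ(B(x,r_n))) dν(x)`. -/
def Mart (μ : Measure (EuclideanSpace ℝ (Fin d))) (r : ℕ → ℝ)
    (ν : Measure (EuclideanSpace ℝ (Fin d))) (k : ℕ) (ω : ℕ → EuclideanSpace ℝ (Fin d)) : ℝ :=
  ∫ x, ∏ n ∈ Finset.range k,
    (1 - Set.indicator (ball (ω n) (r n)) (fun _ => (1 : ℝ)) x) /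
      (1 - (μ (ball x (r n))).toReal) ∂ν

/-- The integrand of `Mart`: the normalised indicator that none of the first `k` balls
contains `x`. -/
def avoidWeight (μ : Measure (EuclideanSpace ℝ (Fin d))) (r : ℕ → ℝ) (k : ℕ)
    (ω : ℕ → EuclideanSpace ℝ (Fin d)) (x : EuclideanSpace ℝ (Fin d)) : ℝ :=
  ∏ n ∈ Finset.range k,
    (1 - Set.indicator (ball (ω n) (r n)) (fun _ => (1 : ℝ)) x) /
      (1 - (μ (ball x (r n))).toReal)

lemma isOpen_setOf_mem_ball {X : Type*} [PseudoMetricSpace X] (n : ℕ) (ρ : ℝ) :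
    IsOpen {p : (ℕ → X) × X | p.2 ∈ ball (p.1 n) ρ} := by
  simp only [mem_ball]
  exact isOpen_lt (by fun_prop) continuous_const

lemma isOpen_setOf_subset_biUnion_ball {X : Type*} [PseudoMetricSpace X] {A : Set X}
    (hA : IsCompact A) (r : ℕ → ℝ) (s : Set ℕ) :
    IsOpen {ω : ℕ → X | A ⊆ ⋃ n ∈ s, ball (ω n) (r n)} := by
  rw [isOpen_iff_mem_nhds]
  intro ω₀ h
  refine hA.eventually_forall_of_forall_eventually
    (P := fun (ω : ℕ → X) x => x ∈ ⋃ n ∈ s, ball (ω n) (r n)) fun y hy => ?_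
  obtain ⟨n, hns, hn⟩ := mem_iUnion₂.1 (h hy)
  filter_upwards [(isOpen_setOf_mem_ball n (r n)).mem_nhds (show (ω₀, y) ∈ _ from hn)] with z hz
  exact mem_iUnion₂.2 ⟨n, hns, hz⟩

lemma subset_coverSet_iff (A : Set (EuclideanSpace ℝ (Fin d))) (r : ℕ → ℝ)
    (ω : ℕ → EuclideanSpace ℝ (Fin d)) (i : ℕ) :
    A ⊆ coverSet r ω ↔ ∀ k, A ⊆ ⋃ n, ball (ω (n + (i + k))) (r (n + (i + k))) := by
  simp only [coverSet, subset_iInter_iff]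
  constructor
  · intro h k x hx
    obtain ⟨n, hn, hxn⟩ := mem_iUnion₂.1 (h (i + k) hx)
    exact mem_iUnion.2 ⟨n - (i + k), by rwa [Nat.sub_add_cancel hn]⟩
  · intro h k x hx
    obtain ⟨n, hn⟩ := mem_iUnion.1 (h k hx)
    exact mem_iUnion₂.2 ⟨n + (i + k), by lia, hn⟩

lemma measurableSet_limsup_setOf_subset_coverSet {A : Set (EuclideanSpace ℝ (Fin d))}
    (hA : IsCompact A) (r : ℕ → ℝ) :
    MeasurableSet[limsup (fun n => MeasurableSpace.comap
      (fun ω : ℕ → EuclideanSpace ℝ (Fin d) => ω n) inferInstance) atTop]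
      {ω : ℕ → EuclideanSpace ℝ (Fin d) | A ⊆ coverSet r ω} := by
  rw [limsup_eq_iInf_iSup_of_nat, MeasurableSpace.measurableSet_iInf]
  intro i
  simp only [subset_coverSet_iff A r _ i, ofPred_forall]
  refine MeasurableSet.iInter fun k => ?_
  have hopen := isOpen_setOf_subset_biUnion_ball hA (fun n => r (n + (i + k))) univ
  simp only [mem_univ, iUnion_true] at hopen
  suffices h : Measurable[⨆ j ≥ i, MeasurableSpace.comap
      (fun ω : ℕ → EuclideanSpace ℝ (Fin d) => ω j) inferInstance]
      (fun (ω : ℕ → EuclideanSpace ℝ (Fin d)) n => ω (n + (i + k))) from h hopen.measurableSet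
  refine @measurable_pi_lambda _ _ _ (_) _ _ fun n => ?_
  rw [measurable_iff_comap_le]
  exact le_iSup₂_of_le (n + (i + k)) (by lia) le_rfl

lemma measurable_avoidWeight (μ : Measure (EuclideanSpace ℝ (Fin d))) [SFinite μ] (r : ℕ → ℝ)
    (k : ℕ) : Measurable fun p : (ℕ → EuclideanSpace ℝ (Fin d)) × EuclideanSpace ℝ (Fin d) =>
      avoidWeight μ r k p.1 p.2 := by
  unfold avoidWeight
  refine Finset.measurable_prod _ fun n _ => Measurable.div ?_ ?_
  · refine measurable_const.sub ?_
    exact (measurable_const (a := (1 : ℝ))).indicator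
      (isOpen_setOf_mem_ball (X := EuclideanSpace ℝ (Fin d)) n (r n)).measurableSet
  · refine measurable_const.sub (Measurable.ennreal_toReal ?_)
    have h : MeasurableSet {q : EuclideanSpace ℝ (Fin d) × EuclideanSpace ℝ (Fin d) |
        dist q.2 q.1 < r n} :=
      (isOpen_lt (by fun_prop) continuous_const).measurableSet
    exact (measurable_measure_prodMk_left h).comp measurable_snd

lemma avoidWeight_eq_indicator_div (μ : Measure (EuclideanSpace ℝ (Fin d))) (r : ℕ → ℝ) (k : ℕ)
    (ω : ℕ → EuclideanSpace ℝ (Fin d)) (x : EuclideanSpace ℝ (Fin d)) :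
    avoidWeight μ r k ω x =
      Set.indicator {ω | ∀ n ∈ Finset.range k, ω n ∈ (ball x (r n))ᶜ} (fun _ => (1 : ℝ)) ω /
        ∏ n ∈ Finset.range k, (1 - (μ (ball x (r n))).toReal) := by
  rw [avoidWeight, Finset.prod_div_distrib]
  congr 1
  by_cases h : ω ∈ {ω | ∀ n ∈ Finset.range k, ω n ∈ (ball x (r n))ᶜ}
  · rw [indicator_of_mem h]
    refine Finset.prod_eq_one fun n hn => ?_
    rw [indicator_of_notMem (fun hx => h n hn (mem_ball_comm.1 hx)), sub_zero]
  · rw [indicator_of_notMem h]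
    simp only [mem_ofPred_eq, not_forall, mem_compl_iff, not_not] at h
    obtain ⟨n, hn, hx⟩ := h
    refine Finset.prod_eq_zero hn ?_
    rw [indicator_of_mem (mem_ball_comm.1 hx), sub_self]

lemma integral_avoidWeight (μ : Measure (EuclideanSpace ℝ (Fin d))) [IsProbabilityMeasure μ]
    (P : Measure (ℕ → EuclideanSpace ℝ (Fin d)))
    (hP : ∀ (s : Finset ℕ) (f : ℕ → Set (EuclideanSpace ℝ (Fin d))),
      (∀ n, MeasurableSet (f n)) → P {ω | ∀ n ∈ s, ω n ∈ f n} = ∏ n ∈ s, μ (f n))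
    (r : ℕ → ℝ) (k : ℕ) {x : EuclideanSpace ℝ (Fin d)}
    (hx : ∀ n, (μ (ball x (r n))).toReal < 1) :
    ∫ ω, avoidWeight μ r k ω x ∂P = 1 := by
  have hm : MeasurableSet {ω : ℕ → EuclideanSpace ℝ (Fin d) |
      ∀ n ∈ Finset.range k, ω n ∈ (ball x (r n))ᶜ} := by
    simp only [ofPred_forall]
    exact .iInter fun n => .iInter fun _ => measurable_pi_apply n measurableSet_ball.compl
  simp_rw [avoidWeight_eq_indicator_div]
  rw [integral_div, integral_indicator_const _ hm, measureReal_def,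
    hP _ (fun n => (ball x (r n))ᶜ) (fun n => measurableSet_ball.compl), ENNReal.toReal_prod,
    smul_eq_mul, mul_one]
  have h (n : ℕ) : (μ (ball x (r n))ᶜ).toReal = 1 - (μ (ball x (r n))).toReal :=
    probReal_compl_eq_one_sub measurableSet_ball
  simp_rw [h]
  exact div_self (Finset.prod_ne_zero_iff.2 fun n _ => (sub_pos.2 (hx n)).ne')

lemma avoidWeight_nonneg (μ : Measure (EuclideanSpace ℝ (Fin d))) [IsProbabilityMeasure μ]
    (r : ℕ → ℝ) (k : ℕ) (ω : ℕ → EuclideanSpace ℝ (Fin d)) (x : EuclideanSpace ℝ (Fin d)) :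
    0 ≤ avoidWeight μ r k ω x := by
  rw [avoidWeight_eq_indicator_div]
  refine div_nonneg (indicator_nonneg (fun _ _ => zero_le_one) _) ?_
  exact Finset.prod_nonneg fun n _ => sub_nonneg.2 measureReal_le_one

lemma avoidWeight_le (μ : Measure (EuclideanSpace ℝ (Fin d)))
    (r : ℕ → ℝ) (k : ℕ) (ω : ℕ → EuclideanSpace ℝ (Fin d)) {x : EuclideanSpace ℝ (Fin d)}
    {s : ℝ} (hs : s < 1) (hx : ∀ n, (μ (ball x (r n))).toReal ≤ s) :
    avoidWeight μ r k ω x ≤ ((1 - s) ^ k)⁻¹ := by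
  have hs' : 0 < 1 - s := sub_pos.2 hs
  rw [avoidWeight_eq_indicator_div, inv_eq_one_div]
  refine div_le_div₀ zero_le_one (indicator_le_self' (fun _ _ => zero_le_one) _) (by positivity) ?_
  simpa using Finset.prod_le_prod (s := Finset.range k) (f := fun _ => 1 - s)
    (g := fun n => 1 - (μ (ball x (r n))).toReal) (fun _ _ => hs'.le)
    (fun n _ => sub_le_sub_left (hx n) 1)

/-- A weak form of the Paley–Zygmund inequality. -/
lemma inv_le_measureReal_of_integral_sq_le {Ω : Type*} [MeasurableSpace Ω] {P : Measure Ω}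
    [IsFiniteMeasure P] {f : Ω → ℝ} {C : ℝ} (hC : 0 < C) (hf : Integrable f P)
    (hf2 : Integrable (fun ω => f ω ^ 2) P) (h1 : ∫ ω, f ω ∂P = 1)
    (h2 : ∫ ω, f ω ^ 2 ∂P ≤ C) {S : Set Ω} (hS : MeasurableSet S) (h0 : ∀ ω ∉ S, f ω = 0) :
    C⁻¹ ≤ P.real S := by
  have hle (ω : Ω) : f ω ≤ f ω ^ 2 / (2 * C) + S.indicator (fun _ => C / 2) ω := by
    by_cases hω : ω ∈ S
    · rw [indicator_of_mem hω]
      have : f ω ^ 2 / (2 * C) + C / 2 - f ω = (f ω - C) ^ 2 / (2 * C) := by field_simp; ring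
      have : 0 ≤ (f ω - C) ^ 2 / (2 * C) := by positivity
      linarith
    · simp [indicator_of_notMem hω, h0 ω hω]
  have hi : Integrable (S.indicator fun _ : Ω => C / 2) P := (integrable_const _).indicator hS
  have h := integral_mono hf ((hf2.div_const _).add hi) hle
  simp only [Pi.add_apply] at h
  rw [integral_add (hf2.div_const _) hi, integral_div, integral_indicator_const _ hS, h1,
    smul_eq_mul] at h
  have : (∫ ω, f ω ^ 2 ∂P) / (2 * C) ≤ 1 / 2 := by
    rw [div_le_div_iff₀ (by positivity) two_pos]; linarith
  rw [inv_le_iff_one_le_mul₀ hC]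
  linarith

lemma measure_setOf_mem_coverSet_eq_zero {μ : Measure (EuclideanSpace ℝ (Fin d))}
    {P : Measure (ℕ → EuclideanSpace ℝ (Fin d))}
    (hP : ∀ (s : Finset ℕ) (f : ℕ → Set (EuclideanSpace ℝ (Fin d))),
      (∀ n, MeasurableSet (f n)) → P {ω | ∀ n ∈ s, ω n ∈ f n} = ∏ n ∈ s, μ (f n))
    {r : ℕ → ℝ} (hlim : Tendsto r atTop (𝓝 0)) {x : EuclideanSpace ℝ (Fin d)}
    (hx : x ∉ msupport μ) : P {ω | x ∈ coverSet r ω} = 0 := by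
  simp only [msupport, mem_ofPred_eq, not_forall, not_lt, nonpos_iff_eq_zero] at hx
  obtain ⟨U, hU, hxU, hμU⟩ := hx
  obtain ⟨ε, hε, hεU⟩ := Metric.isOpen_iff.1 hU x hxU
  obtain ⟨N, hN⟩ := eventually_atTop.1 (hlim.eventually_lt_const hε)
  have hsub : {ω | x ∈ coverSet r ω} ⊆ ⋃ n, ⋃ (_ : N ≤ n), {ω | ω n ∈ ball x (r n)} := by
    intro ω hω
    simp only [coverSet, mem_ofPred_eq, mem_iInter] at hω
    simpa only [mem_iUnion, mem_ofPred_eq, mem_ball_comm] using hω N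
  refine measure_mono_null hsub (measure_iUnion_null fun n => measure_iUnion_null fun hn => ?_)
  have h := hP {n} (fun _ => ball x (r n)) fun _ => measurableSet_ball
  simp only [Finset.mem_singleton, forall_eq, Finset.prod_singleton] at h
  rw [h]
  exact measure_mono_null ((ball_subset_ball (hN n hn).le).trans hεU) hμU

/-- Billard's condition: if some probability measure `ν` supported on the compact set `A` has
bounded second moments `𝔼(M_{k,ν}²)`, then `A` is `ℙ_μ`-a.s. not covered by `E_r`. -/
theorem not_covered_of_bounded_second_moments
    (μ : Measure (EuclideanSpace ℝ (Fin d))) [IsProbabilityMeasure μ]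
    (P : Measure (ℕ → EuclideanSpace ℝ (Fin d)))
    (hP : ∀ (s : Finset ℕ) (f : ℕ → Set (EuclideanSpace ℝ (Fin d))),
      (∀ n, MeasurableSet (f n)) →
      P {ω | ∀ n ∈ s, ω n ∈ f n} = ∏ n ∈ s, μ (f n))
    (r : ℕ → ℝ) (hmono : Antitone r) (hpos : ∀ n, 0 < r n)
    (hlim : Tendsto r atTop (𝓝 0))
    (hsmall : (⨆ x ∈ msupport μ, μ (ball x (r 0))) < 1)
    (A : Set (EuclideanSpace ℝ (Fin d))) (hne : A.Nonempty) (hAc : IsCompact A)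
    (ν : Measure (EuclideanSpace ℝ (Fin d))) (hν : IsProbabilityMeasure ν)
    (hνA : msupport ν ⊆ A) (hνfull : ν (msupport ν)ᶜ = 0)
    (hbounded : ∃ C : ℝ, ∀ k : ℕ, (∫ ω, (Mart μ r ν k ω) ^ 2 ∂P) ≤ C) :
    P {ω | A ⊆ coverSet r ω} = 0 := by
  by_cases hAX : A ⊆ msupport μ
  swap
  · obtain ⟨x, hxA, hx⟩ := not_subset.1 hAX
    exact measure_mono_null (fun ω hω => hω hxA) (measure_setOf_mem_coverSet_eq_zero hP hlim hx)
  have hPpi : P = Measure.infinitePi fun _ : ℕ => μ :=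
    Measure.eq_infinitePi _ fun s f hf => hP s f hf
  have hPprob : IsProbabilityMeasure P := by rw [hPpi]; infer_instance
  have hindep : ProbabilityTheory.iIndep (fun n => MeasurableSpace.comap
      (fun ω : ℕ → EuclideanSpace ℝ (Fin d) => ω n) inferInstance) P := by
    rw [hPpi]
    exact (ProbabilityTheory.iIndepFun_infinitePi (P := fun _ : ℕ => μ)
      (X := fun _ x => x) fun _ => measurable_id).iIndep
  refine (ProbabilityTheory.measure_zero_or_one_of_measurableSet_limsup_atTop
    (fun n => (measurable_pi_apply n).comap_le) hindep
    (measurableSet_limsup_setOf_subset_coverSet hAc r)).resolve_right ?_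
  set s : ℝ := (⨆ x ∈ msupport μ, μ (ball x (r 0))).toReal with hs_def
  have hs : s < 1 := by
    rw [hs_def, ← ENNReal.toReal_one]
    exact (ENNReal.toReal_lt_toReal hsmall.ne_top ENNReal.one_ne_top).2 hsmall
  have hball : ∀ x ∈ msupport ν, ∀ n, (μ (ball x (r n))).toReal ≤ s := fun x hx n =>
    ENNReal.toReal_mono hsmall.ne_top <|
      (measure_mono (ball_subset_ball (hmono n.zero_le))).trans
        (le_iSup₂_of_le (f := fun x (_ : x ∈ msupport μ) => μ (ball x (r 0)))
          x (hAX (hνA hx)) le_rfl)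
  have hae : ∀ᵐ x ∂ν, x ∈ msupport ν := hνfull
  have hbound (k : ℕ) (ω) : ∀ᵐ x ∂ν, ‖avoidWeight μ r k ω x‖ ≤ ((1 - s) ^ k)⁻¹ := by
    filter_upwards [hae] with x hx
    rw [Real.norm_of_nonneg (avoidWeight_nonneg μ r k ω x)]
    exact avoidWeight_le μ r k ω hs (hball x hx)
  have hint (k : ℕ) : Integrable (fun p : (ℕ → EuclideanSpace ℝ (Fin d)) ×
      EuclideanSpace ℝ (Fin d) => avoidWeight μ r k p.1 p.2) (P.prod ν) := by
    refine Integrable.of_bound (measurable_avoidWeight μ r k).aestronglyMeasurable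
      ((1 - s) ^ k)⁻¹ ?_
    filter_upwards [Measure.quasiMeasurePreserving_snd.ae hae] with p hp
    rw [Real.norm_of_nonneg (avoidWeight_nonneg μ r k p.1 p.2)]
    exact avoidWeight_le μ r k p.1 hs (hball p.2 hp)
  have hMint (k : ℕ) : Integrable (Mart μ r ν k) P := (hint k).integral_prod_left
  have hMbound (k : ℕ) (ω) : ‖Mart μ r ν k ω‖ ≤ ((1 - s) ^ k)⁻¹ := by
    have h := norm_integral_le_of_norm_le_const (hbound k ω)
    rwa [probReal_univ, mul_one] at h
  have hM2int (k : ℕ) : Integrable (fun ω => Mart μ r ν k ω ^ 2) P := by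
    refine Integrable.of_bound ((hMint k).aestronglyMeasurable.pow 2) ((((1 - s) ^ k)⁻¹) ^ 2) ?_
    refine ae_of_all _ fun ω => ?_
    rw [norm_pow]
    exact pow_le_pow_left₀ (norm_nonneg _) (hMbound k ω) 2
  have hM1 (k : ℕ) : ∫ ω, Mart μ r ν k ω ∂P = 1 := by
    change ∫ ω, ∫ x, avoidWeight μ r k ω x ∂ν ∂P = 1
    rw [integral_integral_swap (hint k)]
    have : (fun x => ∫ ω, avoidWeight μ r k ω x ∂P) =ᵐ[ν] fun _ => 1 := by
      filter_upwards [hae] with x hx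
      exact integral_avoidWeight μ P hP r k fun n => (hball x hx n).trans_lt hs
    rw [integral_congr_ae this]
    simp
  have hM0 (k : ℕ) (ω) (h : A ⊆ ⋃ n ∈ Iio k, ball (ω n) (r n)) : Mart μ r ν k ω = 0 := by
    refine integral_eq_zero_of_ae ?_
    filter_upwards [hae] with x hx
    obtain ⟨n, hn, hxn⟩ := mem_iUnion₂.1 (h (hνA hx))
    exact Finset.prod_eq_zero (Finset.mem_range.2 hn) (by rw [indicator_of_mem hxn, sub_self, zero_div])
  obtain ⟨C, hC⟩ := hbounded
  have hC0 : 0 < max C 1 := lt_max_of_lt_right one_pos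
  let T : ℕ → Set (ℕ → EuclideanSpace ℝ (Fin d)) :=
    fun k => {ω | A ⊆ ⋃ n ∈ Iio k, ball (ω n) (r n)}
  have hTmeas (k : ℕ) : MeasurableSet (T k) :=
    (isOpen_setOf_subset_biUnion_ball hAc r (Iio k)).measurableSet
  have hTle (k : ℕ) : P (T k) ≤ ENNReal.ofReal (1 - (max C 1)⁻¹) := by
    have h := inv_le_measureReal_of_integral_sq_le hC0 (hMint k) (hM2int k) (hM1 k)
      ((hC k).trans (le_max_left C 1)) (hTmeas k).compl
      fun ω hω => hM0 k ω (not_not.1 hω)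
    rw [probReal_compl_eq_one_sub (hTmeas k)] at h
    rw [← ofReal_measureReal]
    exact ENNReal.ofReal_le_ofReal (by linarith)
  have hTmono : Monotone T := fun i j hij ω hω =>
    Subset.trans hω (biUnion_subset_biUnion_left (Iio_subset_Iio hij))
  have hsub : {ω | A ⊆ coverSet r ω} ⊆ ⋃ k, T k := by
    intro ω hω
    have hcov : A ⊆ ⋃ k, ⋃ n ∈ Iio k, ball (ω n) (r n) := fun x hx => by
      obtain ⟨n, hn⟩ := mem_iUnion.1 ((subset_coverSet_iff A r ω 0).1 hω 0 hx)
      exact mem_iUnion.2 ⟨n + 1, mem_iUnion₂.2 ⟨n, n.lt_succ_self, by simpa using hn⟩⟩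
    obtain ⟨k, hk⟩ := hAc.elim_directed_cover _
      (fun k => isOpen_biUnion fun n _ => isOpen_ball) hcov
      (Monotone.directed_le fun i j hij => biUnion_subset_biUnion_left (Iio_subset_Iio hij))
    exact mem_iUnion.2 ⟨k, hk⟩
  refine ne_of_lt ((measure_mono hsub).trans_lt ?_)
  rw [hTmono.measure_iUnion]
  refine (iSup_le hTle).trans_lt ?_
  rw [ENNReal.ofReal_lt_one]
  exact sub_lt_self 1 (inv_pos.2 hC0)

end
end

section
/- Let μ be a Borel probability measure on ℝ^d with support X, let c, t > 0, and let r = (c n^{−t})_{n≥1}. (1) If 1/t < sup_{x∈X} ldim(μ,x), then ℙ_μ({ω : X ⊆ E_r(ω)}) = 0. (2) If 1/t > sup_{x∈X} ldim(μ,x), then ℙ_μ({ω : X ⊆ E_r(ω)}) = 1. -/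
open MeasureTheory Metric Filter Set
open scoped ENNReal Topology

noncomputable section

variable {d : ℕ}

/-- The lower local dimension `liminf_{ρ→0} log μ(B(x,ρ)) / log ρ` of `μ` at `x`. -/
def ldim (μ : Measure (EuclideanSpace ℝ (Fin d))) (x : EuclideanSpace ℝ (Fin d)) : EReal :=
  liminf (fun ρ : ℝ => ((Real.log (μ (ball x ρ)).toReal / Real.log ρ : ℝ) : EReal)) (𝓝[>] 0)

/-- A set whose finite `δ`-separated subsets have bounded cardinality contains a finite
`δ`-separated `δ`-net. -/
theorem exists_finset_separated_net {α : Type*} [PseudoMetricSpace α] (A : Set α) (δ : ℝ) (K : ℕ)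
    (hK : ∀ F : Finset α, ↑F ⊆ A → (F : Set α).Pairwise (fun x y => δ ≤ dist x y) → F.card ≤ K) :
    ∃ F : Finset α, ↑F ⊆ A ∧ (F : Set α).Pairwise (fun x y => δ ≤ dist x y) ∧
      ∀ x ∈ A, x ∉ F → ∃ y ∈ F, dist x y < δ := by
  classical
  let p : ℕ → Prop := fun n => ∃ F : Finset α, ↑F ⊆ A ∧
    (F : Set α).Pairwise (fun x y => δ ≤ dist x y) ∧ F.card = n
  have h0 : p 0 := ⟨∅, by simp, by simp, rfl⟩
  obtain ⟨F, hFA, hF, hcard⟩ : p (Nat.findGreatest p K) :=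
    Nat.findGreatest_spec (Nat.zero_le K) h0
  refine ⟨F, hFA, hF, fun x hx hxF => ?_⟩
  by_contra! hfar
  have hsub : ↑(insert x F) ⊆ A := by
    rw [Finset.coe_insert]
    exact Set.insert_subset hx hFA
  have hsep : ((insert x F : Finset α) : Set α).Pairwise (fun x y => δ ≤ dist x y) := by
    rw [Finset.coe_insert]
    refine hF.insert fun y hy _ => ⟨hfar y hy, ?_⟩
    rw [dist_comm]
    exact hfar y hy
  have hle := Nat.le_findGreatest (P := p) (hK _ hsub hsep) ⟨_, hsub, hsep, rfl⟩
  rw [Finset.card_insert_of_notMem hxF] at hle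
  omega

/-- Pairwise `2δ`-separated points whose `δ`-balls have mass at least `q` number at most `q⁻¹`. -/
theorem card_mul_le_one_of_separated (μ : Measure (EuclideanSpace ℝ (Fin d)))
    [IsProbabilityMeasure μ] {δ q : ℝ} (F : Finset (EuclideanSpace ℝ (Fin d)))
    (hF : ∀ x ∈ F, q ≤ μ.real (ball x δ))
    (hsep : (F : Set (EuclideanSpace ℝ (Fin d))).Pairwise (fun x y => 2 * δ ≤ dist x y)) :
    F.card * q ≤ 1 := by
  have hdisj : (F : Set (EuclideanSpace ℝ (Fin d))).PairwiseDisjoint (fun x => ball x δ) := by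
    intro x hx y hy hxy
    exact ball_disjoint_ball (by linarith [hsep hx hy hxy])
  calc F.card * q = ∑ _x ∈ F, q := by simp
    _ ≤ ∑ x ∈ F, μ.real (ball x δ) := Finset.sum_le_sum hF
    _ = μ.real (⋃ x ∈ F, ball x δ) :=
        (measureReal_biUnion_finset hdisj fun x _ => measurableSet_ball).symm
    _ ≤ 1 := measureReal_le_one

/-- The points whose `δ`-balls have mass at least `q` are covered by the balls of radius `3δ`
around `M - N` independent samples, up to an event of exponentially small probability. -/
theorem measure_not_subset_iUnion_ball_le (μ : Measure (EuclideanSpace ℝ (Fin d)))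
    [IsProbabilityMeasure μ] (P : Measure (ℕ → EuclideanSpace ℝ (Fin d)))
    (hP : ∀ (s : Finset ℕ) (f : ℕ → Set (EuclideanSpace ℝ (Fin d))),
      (∀ n, MeasurableSet (f n)) →
      P {ω | ∀ n ∈ s, ω n ∈ f n} = ∏ n ∈ s, μ (f n))
    {δ q : ℝ} (hδ : 0 < δ) (hq : 0 < q) (N M : ℕ) :
    P {ω | ¬ {x | q ≤ μ.real (ball x δ)} ⊆ ⋃ n ∈ Finset.Ico N M, ball (ω n) (3 * δ)} ≤
      ENNReal.ofReal (q⁻¹ * Real.exp (-(q * ((M : ℝ) - N)))) := by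
  obtain ⟨F, hFA, hsep, hnet⟩ := exists_finset_separated_net {x | q ≤ μ.real (ball x δ)} (2 * δ)
    ⌊q⁻¹⌋₊ (fun F hFA hF => by
      have h := card_mul_le_one_of_separated μ F hFA hF
      refine Nat.le_floor ?_
      rwa [← one_div, le_div_iff₀ hq])
  have hcard : (F.card : ℝ) ≤ q⁻¹ := by
    rw [← one_div, le_div_iff₀ hq]
    exact card_mul_le_one_of_separated μ F hFA hsep
  have hsub : {ω : ℕ → EuclideanSpace ℝ (Fin d) |
      ¬ {x | q ≤ μ.real (ball x δ)} ⊆ ⋃ n ∈ Finset.Ico N M, ball (ω n) (3 * δ)} ⊆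
      ⋃ y ∈ F, {ω | ∀ n ∈ Finset.Ico N M, ω n ∈ (ball y δ)ᶜ} := by
    intro ω hω
    by_contra hcon
    refine hω fun x hx => ?_
    simp only [mem_iUnion, mem_ofPred_eq, not_exists, not_forall, mem_compl_iff, not_not] at hcon
    obtain ⟨y, hy, hxy⟩ : ∃ y ∈ F, dist x y < 2 * δ := by
      by_cases hxF : x ∈ F
      · exact ⟨x, hxF, by simpa using hδ⟩
      · exact hnet x hx hxF
    obtain ⟨n, hn, hny⟩ := hcon y hy
    simp only [mem_iUnion]
    refine ⟨n, hn, ?_⟩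
    rw [mem_ball] at hny ⊢
    linarith [dist_triangle_right x (ω n) y]
  have hone : ∀ y ∈ F, P {ω | ∀ n ∈ Finset.Ico N M, ω n ∈ (ball y δ)ᶜ} ≤
      ENNReal.ofReal (Real.exp (-(q * ((M : ℝ) - N)))) := by
    intro y hy
    rw [hP _ (fun _ => (ball y δ)ᶜ) fun _ => measurableSet_ball.compl]
    have hcompl : μ.real (ball y δ)ᶜ ≤ Real.exp (-q) := by
      rw [probReal_compl_eq_one_sub measurableSet_ball]
      have h1 : q ≤ μ.real (ball y δ) := hFA hy
      linarith [Real.one_sub_le_exp_neg q]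
    rw [Finset.prod_const, Nat.card_Ico, ← ofReal_measureReal,
      ← ENNReal.ofReal_pow measureReal_nonneg]
    refine ENNReal.ofReal_le_ofReal ((pow_le_pow_left₀ measureReal_nonneg hcompl _).trans ?_)
    rw [← Real.exp_nat_mul, Real.exp_le_exp]
    have hMN : (M : ℝ) - N ≤ (M - N : ℕ) := by
      have h : M ≤ (M - N) + N := by omega
      have h' : (M : ℝ) ≤ (M - N : ℕ) + N := by exact_mod_cast h
      linarith
    nlinarith
  calc _ ≤ P (⋃ y ∈ F, {ω | ∀ n ∈ Finset.Ico N M, ω n ∈ (ball y δ)ᶜ}) := measure_mono hsub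
    _ ≤ ∑ y ∈ F, P {ω | ∀ n ∈ Finset.Ico N M, ω n ∈ (ball y δ)ᶜ} := measure_biUnion_finset_le _ _
    _ ≤ ∑ _y ∈ F, ENNReal.ofReal (Real.exp (-(q * ((M : ℝ) - N)))) := Finset.sum_le_sum hone
    _ = ENNReal.ofReal (F.card * Real.exp (-(q * ((M : ℝ) - N)))) := by
        rw [Finset.sum_const, nsmul_eq_mul, ENNReal.ofReal_mul (Nat.cast_nonneg _),
          ENNReal.ofReal_natCast]
    _ ≤ _ := ENNReal.ofReal_le_ofReal (mul_le_mul_of_nonneg_right hcard (Real.exp_nonneg _))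

theorem summable_two_pow_rpow_mul_exp {s ε C : ℝ} (hε : 0 < ε) (hC : 0 < C) :
    Summable fun k : ℕ => ((2 : ℝ) ^ k) ^ s * Real.exp (-C * ((2 : ℝ) ^ k) ^ ε) := by
  have hu : Tendsto (fun k : ℕ => (2 : ℝ) ^ k) atTop atTop :=
    tendsto_pow_atTop_atTop_of_one_lt one_lt_two
  have hbound : ∀ᶠ k : ℕ in atTop,
      ‖((2 : ℝ) ^ k) ^ s * Real.exp (-C * ((2 : ℝ) ^ k) ^ ε)‖ ≤ (1 / 2 : ℝ) ^ k := by
    have ho := (isLittleO_exp_neg_mul_rpow_atTop hC (-(s + 1) / ε)).comp_tendsto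
      ((tendsto_rpow_atTop hε).comp hu)
    filter_upwards [ho.bound one_pos] with k hk
    have hpos : (0 : ℝ) < 2 ^ k := by positivity
    simp only [Function.comp_apply, one_mul] at hk
    rw [← Real.rpow_mul hpos.le, mul_div_cancel₀ _ hε.ne', Real.norm_of_nonneg (Real.exp_nonneg _),
      Real.norm_of_nonneg (Real.rpow_nonneg hpos.le _)] at hk
    rw [Real.norm_of_nonneg (by positivity)]
    calc _ ≤ ((2 : ℝ) ^ k) ^ s * ((2 : ℝ) ^ k) ^ (-(s + 1)) := by gcongr
      _ = (1 / 2 : ℝ) ^ k := by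
        rw [← Real.rpow_add hpos, show s + -(s + 1) = -1 by ring, Real.rpow_neg_one, one_div,
          inv_pow]
  exact Summable.of_norm_bounded_eventually_nat
    (summable_geometric_of_lt_one (by norm_num) (by norm_num)) hbound

theorem measureReal_ball_pos {μ : Measure (EuclideanSpace ℝ (Fin d))} [IsFiniteMeasure μ]
    {x : EuclideanSpace ℝ (Fin d)} (hx : x ∈ msupport μ) {ρ : ℝ} (hρ : 0 < ρ) :
    0 < μ.real (ball x ρ) :=
  ENNReal.toReal_pos (hx _ isOpen_ball (mem_ball_self hρ)).ne' (measure_ne_top _ _)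

theorem eventually_measureReal_ball_le {μ : Measure (EuclideanSpace ℝ (Fin d))}
    [IsFiniteMeasure μ] {x : EuclideanSpace ℝ (Fin d)} (hx : x ∈ msupport μ) {s : ℝ}
    (hs : (s : EReal) < ldim μ x) : ∀ᶠ ρ in 𝓝[>] (0 : ℝ), μ.real (ball x ρ) ≤ ρ ^ s := by
  filter_upwards [eventually_lt_of_lt_liminf hs, Ioo_mem_nhdsGT (zero_lt_one' ℝ)] with ρ h hρ
  rw [EReal.coe_lt_coe_iff, lt_div_iff_of_neg (Real.log_neg hρ.1 hρ.2)] at h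
  rw [← Real.log_le_log_iff (measureReal_ball_pos hx hρ.1) (Real.rpow_pos_of_pos hρ.1 _),
    Real.log_rpow hρ.1]
  exact h.le

theorem frequently_rpow_le_measureReal_ball {μ : Measure (EuclideanSpace ℝ (Fin d))}
    [IsFiniteMeasure μ] {x : EuclideanSpace ℝ (Fin d)} (hx : x ∈ msupport μ) {s : ℝ}
    (hs : ldim μ x < (s : EReal)) : ∃ᶠ ρ in 𝓝[>] (0 : ℝ), ρ ^ s ≤ μ.real (ball x ρ) := by
  refine ((frequently_lt_of_liminf_lt (by isBoundedDefault) hs).and_eventually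
    (Ioo_mem_nhdsGT (zero_lt_one' ℝ))).mono ?_
  rintro ρ ⟨h, hρ⟩
  rw [EReal.coe_lt_coe_iff, div_lt_iff_of_neg (Real.log_neg hρ.1 hρ.2)] at h
  rw [← Real.log_le_log_iff (Real.rpow_pos_of_pos hρ.1 _) (measureReal_ball_pos hx hρ.1),
    Real.log_rpow hρ.1]
  exact h.le

theorem frequently_dyadic_rpow_le_measureReal_ball {μ : Measure (EuclideanSpace ℝ (Fin d))}
    [IsFiniteMeasure μ] {x : EuclideanSpace ℝ (Fin d)} (hx : x ∈ msupport μ) {s : ℝ}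
    (hs0 : 0 < s) (hs : ldim μ x < (s : EReal)) :
    ∃ᶠ k : ℕ in atTop, (((2 : ℝ) ^ k) ^ s)⁻¹ ≤ μ.real (ball x (2 * ((2 : ℝ) ^ k)⁻¹)) := by
  rw [frequently_atTop]
  intro K
  have hK : (0 : ℝ) < ((2 : ℝ) ^ K)⁻¹ := by positivity
  obtain ⟨ρ, hρ, hρ0, hρK⟩ := ((frequently_rpow_le_measureReal_ball hx hs).and_eventually
    (Ioo_mem_nhdsGT hK)).exists
  have hρ1 : ρ ≤ 1 := hρK.le.trans (inv_le_one_of_one_le₀ (one_le_pow₀ one_le_two))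
  obtain ⟨n, hn1, hn2⟩ := exists_nat_pow_near_of_lt_one hρ0 hρ1 (by norm_num : (0 : ℝ) < 1 / 2)
    (by norm_num)
  rw [one_div, inv_pow] at hn1 hn2
  refine ⟨n + 1, ?_, ?_⟩
  · by_contra! hlt
    have : ((2 : ℝ) ^ K)⁻¹ ≤ ((2 : ℝ) ^ (n + 1))⁻¹ := by
      gcongr
      · norm_num
    linarith
  · calc (((2 : ℝ) ^ (n + 1)) ^ s)⁻¹ = (((2 : ℝ) ^ (n + 1))⁻¹) ^ s :=
          (Real.inv_rpow (by positivity) _).symm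
      _ ≤ ρ ^ s := Real.rpow_le_rpow (by positivity) hn1.le hs0.le
      _ ≤ μ.real (ball x ρ) := hρ
      _ ≤ _ := by
        refine measureReal_mono (ball_subset_ball (hn2.trans (le_of_eq ?_)))
        rw [pow_succ]
        field_simp

theorem measure_msupport_subset_coverSet_eq_zero
    (μ : Measure (EuclideanSpace ℝ (Fin d))) [IsProbabilityMeasure μ]
    (P : Measure (ℕ → EuclideanSpace ℝ (Fin d)))
    (hP : ∀ (s : Finset ℕ) (f : ℕ → Set (EuclideanSpace ℝ (Fin d))),
      (∀ n, MeasurableSet (f n)) →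
      P {ω | ∀ n ∈ s, ω n ∈ f n} = ∏ n ∈ s, μ (f n))
    {c t : ℝ} (hc : 0 < c) (ht : 0 < t)
    {r : ℕ → ℝ} (hr : ∀ n : ℕ, r n = c * ((n + 1 : ℕ) : ℝ) ^ (-t))
    (h : ((1 / t : ℝ) : EReal) < ⨆ x ∈ msupport μ, ldim μ x) :
    P {ω | msupport μ ⊆ coverSet r ω} = 0 := by
  simp only [lt_iSup_iff] at h
  obtain ⟨x, hx, hxt⟩ := h
  obtain ⟨s, hts, hsx⟩ := EReal.lt_iff_exists_real_btwn.1 hxt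
  rw [EReal.coe_lt_coe_iff, div_lt_iff₀ ht] at hts
  have hr0 : ∀ n, 0 < r n := fun n => by rw [hr]; positivity
  have hlim : Tendsto r atTop (𝓝[>] 0) := by
    refine tendsto_nhdsWithin_iff.2 ⟨?_, Eventually.of_forall hr0⟩
    have h1 := ((tendsto_rpow_neg_atTop ht).comp
      (tendsto_natCast_atTop_atTop.comp (tendsto_add_atTop_nat 1))).const_mul c
    rw [mul_zero] at h1
    exact h1.congr fun n => (hr n).symm
  have hsum : Summable fun n => μ.real (ball x (r n)) := by
    have hmaj : Summable fun n : ℕ => c ^ s * ((n + 1 : ℕ) : ℝ) ^ (-(s * t)) :=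
      ((summable_nat_add_iff 1).2 (Real.summable_nat_rpow.2 (by linarith))).mul_left _
    refine Summable.of_norm_bounded_eventually_nat hmaj ?_
    filter_upwards [hlim.eventually (eventually_measureReal_ball_le hx hsx)] with n hn
    rw [Real.norm_of_nonneg measureReal_nonneg]
    refine hn.trans_eq ?_
    rw [hr, Real.mul_rpow hc.le (by positivity), ← Real.rpow_mul (by positivity)]
    ring_nf
  have heq : ∀ n, P {ω | ω n ∈ ball x (r n)} = ENNReal.ofReal (μ.real (ball x (r n))) := by
    intro n
    simpa using hP {n} (fun _ => ball x (r n)) fun _ => measurableSet_ball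
  have hfreq := measure_limsup_atTop_eq_zero (μ := P) (s := fun n => {ω | ω n ∈ ball x (r n)}) (by
    simp_rw [heq]
    exact hsum.tsum_ofReal_ne_top)
  refine measure_mono_null (fun ω hω => ?_) hfreq
  rw [mem_limsup_iff_frequently_mem, frequently_atTop]
  intro k
  have hk := mem_iInter.1 (hω hx) k
  simp only [mem_iUnion] at hk
  obtain ⟨n, hkn, hn⟩ := hk
  exact ⟨n, hkn, mem_ball_comm.1 hn⟩

theorem ae_msupport_subset_iUnion_ball
    (μ : Measure (EuclideanSpace ℝ (Fin d))) [IsProbabilityMeasure μ]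
    (P : Measure (ℕ → EuclideanSpace ℝ (Fin d)))
    (hP : ∀ (s : Finset ℕ) (f : ℕ → Set (EuclideanSpace ℝ (Fin d))),
      (∀ n, MeasurableSet (f n)) →
      P {ω | ∀ n ∈ s, ω n ∈ f n} = ∏ n ∈ s, μ (f n))
    {c t : ℝ} (hc : 0 < c) (ht : 0 < t)
    {r : ℕ → ℝ} (hr : ∀ n : ℕ, r n = c * ((n + 1 : ℕ) : ℝ) ^ (-t))
    {s : ℝ} (hs0 : 0 < s) (hst : s < 1 / t) (hs : ∀ x ∈ msupport μ, ldim μ x < (s : EReal))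
    (N : ℕ) :
    ∀ᵐ ω ∂P, msupport μ ⊆ ⋃ n, ⋃ (_ : N ≤ n), ball (ω n) (r n) := by
  let A : ℕ → Set (EuclideanSpace ℝ (Fin d)) := fun k =>
    {x | (((2 : ℝ) ^ k) ^ s)⁻¹ ≤ μ.real (ball x (2 * ((2 : ℝ) ^ k)⁻¹))}
  let M : ℕ → ℕ := fun k => ⌊(c / 6 * 2 ^ k) ^ (1 / t)⌋₊
  let C : ℝ := (c / 6) ^ (1 / t)
  have hC : 0 < C := by positivity
  have hradius : ∀ k, ∀ n < M k, 3 * (2 * ((2 : ℝ) ^ k)⁻¹) ≤ r n := by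
    intro k n hn
    have h1 : ((n + 1 : ℕ) : ℝ) ≤ (c / 6 * 2 ^ k) ^ (1 / t) :=
      (Nat.le_floor_iff (by positivity)).1 hn
    have h2 : ((n + 1 : ℕ) : ℝ) ^ t ≤ c / 6 * 2 ^ k := by
      have := Real.rpow_le_rpow (by positivity) h1 ht.le
      rwa [← Real.rpow_mul (by positivity), one_div, inv_mul_cancel₀ ht.ne', Real.rpow_one] at this
    rw [hr, Real.rpow_neg (by positivity), ← div_eq_mul_inv c, le_div_iff₀ (by positivity)]
    calc 3 * (2 * ((2 : ℝ) ^ k)⁻¹) * ((n + 1 : ℕ) : ℝ) ^ t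
        ≤ 3 * (2 * ((2 : ℝ) ^ k)⁻¹) * (c / 6 * 2 ^ k) := by gcongr
      _ = c := by field_simp; norm_num
  have hbound : ∀ k, P {ω | ¬ A k ⊆ ⋃ n ∈ Finset.Ico N (M k),
      ball (ω n) (3 * (2 * ((2 : ℝ) ^ k)⁻¹))} ≤
      ENNReal.ofReal (Real.exp (N + 1) *
        (((2 : ℝ) ^ k) ^ s * Real.exp (-C * ((2 : ℝ) ^ k) ^ (1 / t - s)))) := by
    intro k
    refine (measure_not_subset_iUnion_ball_le μ P hP (by positivity) (by positivity) N (M k)).trans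
      (ENNReal.ofReal_le_ofReal ?_)
    have hu : (0 : ℝ) < 2 ^ k := by positivity
    have hus : 1 ≤ ((2 : ℝ) ^ k) ^ s := Real.one_le_rpow (one_le_pow₀ one_le_two) hs0.le
    rw [inv_inv, mul_left_comm, ← Real.exp_add]
    gcongr
    have hM : C * ((2 : ℝ) ^ k) ^ (1 / t) - 1 ≤ M k := by
      have := Nat.lt_floor_add_one ((c / 6 * 2 ^ k) ^ (1 / t))
      rw [Real.mul_rpow (by positivity) hu.le] at this
      simp only [M, C]
      rw [Real.mul_rpow (by positivity) hu.le]
      linarith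
    have hN : (((2 : ℝ) ^ k) ^ s)⁻¹ * (N + 1) ≤ N + 1 :=
      mul_le_of_le_one_left (by positivity) (inv_le_one_of_one_le₀ hus)
    have hMs := mul_le_mul_of_nonneg_left hM (inv_nonneg.2 (zero_le_one.trans hus))
    rw [Real.rpow_sub hu, div_eq_mul_inv]
    linarith
  have hae : ∀ᵐ ω ∂P, ∀ᶠ k in atTop, A k ⊆ ⋃ n ∈ Finset.Ico N (M k),
      ball (ω n) (3 * (2 * ((2 : ℝ) ^ k)⁻¹)) := by
    have hsum := ((summable_two_pow_rpow_mul_exp (s := s) (sub_pos.2 hst) hC).mul_left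
      (Real.exp (N + 1))).tsum_ofReal_ne_top
    filter_upwards [ae_eventually_notMem (ne_top_of_le_ne_top hsum (ENNReal.tsum_le_tsum hbound))]
      with ω hω
    exact hω.mono fun k hk => not_not.1 hk
  filter_upwards [hae] with ω hω x hx
  obtain ⟨k, hxk, hk⟩ := ((frequently_dyadic_rpow_le_measureReal_ball hx hs0
    (hs x hx)).and_eventually hω).exists
  have hmem := hk hxk
  simp only [mem_iUnion, Finset.mem_Ico] at hmem ⊢
  obtain ⟨n, hn, hxn⟩ := hmem
  exact ⟨n, hn.1, ball_subset_ball (hradius k n hn.2) hxn⟩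

theorem measure_msupport_subset_coverSet_eq_one
    (μ : Measure (EuclideanSpace ℝ (Fin d))) [IsProbabilityMeasure μ]
    (P : Measure (ℕ → EuclideanSpace ℝ (Fin d)))
    (hP : ∀ (s : Finset ℕ) (f : ℕ → Set (EuclideanSpace ℝ (Fin d))),
      (∀ n, MeasurableSet (f n)) →
      P {ω | ∀ n ∈ s, ω n ∈ f n} = ∏ n ∈ s, μ (f n))
    {c t : ℝ} (hc : 0 < c) (ht : 0 < t)
    {r : ℕ → ℝ} (hr : ∀ n : ℕ, r n = c * ((n + 1 : ℕ) : ℝ) ^ (-t))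
    (h : (⨆ x ∈ msupport μ, ldim μ x) < ((1 / t : ℝ) : EReal)) :
    P {ω | msupport μ ⊆ coverSet r ω} = 1 := by
  have ht' : ((0 : ℝ) : EReal) < ((1 / t : ℝ) : EReal) :=
    EReal.coe_lt_coe_iff.2 (one_div_pos.2 ht)
  obtain ⟨s, hs, hst⟩ := EReal.lt_iff_exists_real_btwn.1 (max_lt h ht')
  rw [max_lt_iff] at hs
  have hall := ae_all_iff.2 (ae_msupport_subset_iUnion_ball μ P hP hc ht hr
    (EReal.coe_lt_coe_iff.1 hs.2) (EReal.coe_lt_coe_iff.1 hst)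
    fun x hx => (le_iSup₂ (f := fun x (_ : x ∈ msupport μ) => ldim μ x) x hx).trans_lt hs.1)
  have huniv : P univ = 1 := by
    simpa using hP ∅ (fun _ => univ) fun _ => MeasurableSet.univ
  rw [← huniv]
  refine measure_congr (eventuallyEq_univ.2 ?_)
  filter_upwards [hall] with ω hω
  exact subset_iInter hω

/-- The critical exponent for covering the support by balls of radii `r_n = c n^{-t}`:
if `1/t < sup_{x∈X} ldim(μ,x)` then `X` is a.s. not covered, and if
`1/t > sup_{x∈X} ldim(μ,x)` then `X` is a.s. covered. -/
theorem critical_exponent_polynomial_radii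
    (μ : Measure (EuclideanSpace ℝ (Fin d))) [IsProbabilityMeasure μ]
    (P : Measure (ℕ → EuclideanSpace ℝ (Fin d)))
    (hP : ∀ (s : Finset ℕ) (f : ℕ → Set (EuclideanSpace ℝ (Fin d))),
      (∀ n, MeasurableSet (f n)) →
      P {ω | ∀ n ∈ s, ω n ∈ f n} = ∏ n ∈ s, μ (f n))
    (c t : ℝ) (hc : 0 < c) (ht : 0 < t)
    (r : ℕ → ℝ) (hr : ∀ n : ℕ, r n = c * ((n + 1 : ℕ) : ℝ) ^ (-t)) :
    (((1 / t : ℝ) : EReal) < ⨆ x ∈ msupport μ, ldim μ x →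
        P {ω | msupport μ ⊆ coverSet r ω} = 0) ∧
    ((⨆ x ∈ msupport μ, ldim μ x) < ((1 / t : ℝ) : EReal) →
        P {ω | msupport μ ⊆ coverSet r ω} = 1) := by
  exact ⟨measure_msupport_subset_coverSet_eq_zero μ P hP hc ht hr,
    measure_msupport_subset_coverSet_eq_one μ P hP hc ht hr⟩

end
end

section
/- Let μ be a Borel probability measure on ℝ, let r = (r_n)_{n≥1} be a sequence of positive real numbers, let k ∈ ℕ, let x < y be real numbers, and let A ⊆ ℝ be a μ-measurable set. Write U_k(ω) = ⋃_{n=1}^k B(ω_n, r_n) and F_k(ω) = ℝ ∖ U_k(ω). (i) If A ⊆ (−∞, x) and ℙ_μ(A ⊆ U_k and x ∈ F_k) > 0 (and ℙ_μ(x ∈ F_k) > 0), then ℙ_μ(y ∈ F_k | A ⊆ U_k, x ∈ F_k) ≥ ℙ_μ(y ∈ F_k | x ∈ F_k). (ii) If A ⊆ (y, ∞) and ℙ_μ(A ⊆ U_k and y ∈ F_k) > 0 (and ℙ_μ(y ∈ F_k) > 0), then ℙ_μ(x ∈ F_k | A ⊆ U_k, y ∈ F_k) ≥ ℙ_μ(x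 ∈ F_k | y ∈ F_k). -/
open MeasureTheory Metric Filter Set
open scoped ENNReal Topology

noncomputable section

/-- `U_k(ω) = ⋃_{n=1}^k B(ω_n, r_n)`. -/
def Uk (r : ℕ → ℝ) (k : ℕ) (ω : ℕ → ℝ) : Set ℝ :=
  ⋃ n ∈ Finset.range k, ball (ω n) (r n)

/-- Resampling one coordinate preserves a product measure. -/
theorem map_update_prod {μ : Measure ℝ} [IsProbabilityMeasure μ] {P : Measure (ℕ → ℝ)}
    (hP : ∀ (s : Finset ℕ) (f : ℕ → Set ℝ), (∀ n, MeasurableSet (f n)) →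
      P {ω | ∀ n ∈ s, ω n ∈ f n} = ∏ n ∈ s, μ (f n))
    [IsProbabilityMeasure P] (n : ℕ) :
    (μ.prod P).map (fun q : ℝ × (ℕ → ℝ) => Function.update q.2 n q.1) = P := by
  have hΦ : Measurable (fun q : ℝ × (ℕ → ℝ) => Function.update q.2 n q.1) := by
    refine measurable_pi_lambda _ fun m => ?_
    by_cases h : m = n
    · subst h; simpa using measurable_fst
    · simpa [Function.update_of_ne h, Function.comp_def] using
        (measurable_pi_apply m).comp (measurable_snd (α := ℝ) (β := ℕ → ℝ))
  have hpi : ∀ (s : Finset ℕ) (f : ℕ → Set ℝ),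
      (s : Set ℕ).pi f = {ω | ∀ n ∈ s, ω n ∈ f n} := fun s f => by ext; simp [Set.mem_pi]
  have hP' : P = Measure.infinitePi fun _ : ℕ => μ :=
    Measure.eq_infinitePi _ fun s f hf => by rw [hpi]; exact hP s f hf
  conv_rhs => rw [hP']
  refine Measure.eq_infinitePi _ fun s f hf => ?_
  rw [Measure.map_apply hΦ (MeasurableSet.pi s.countable_toSet fun i _ => hf i), hpi]
  by_cases hn : n ∈ s
  · have : (fun q : ℝ × (ℕ → ℝ) => Function.update q.2 n q.1) ⁻¹' {ω | ∀ n ∈ s, ω n ∈ f n} =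
        f n ×ˢ {ω | ∀ m ∈ s.erase n, ω m ∈ f m} := by
      ext ⟨t, ω⟩
      simp only [mem_preimage, mem_ofPred_eq, mem_prod, Finset.mem_erase]
      constructor
      · intro h
        refine ⟨by simpa using h n hn, fun m hm => ?_⟩
        simpa [Function.update_of_ne hm.1] using h m hm.2
      · rintro ⟨h1, h2⟩ m hm
        by_cases e : m = n
        · subst e; simpa using h1
        · simpa [Function.update_of_ne e] using h2 m ⟨e, hm⟩
    rw [this, Measure.prod_prod, hP _ _ hf, Finset.mul_prod_erase s (fun m => μ (f m)) hn]
  · have : (fun q : ℝ × (ℕ → ℝ) => Function.update q.2 n q.1) ⁻¹' {ω | ∀ n ∈ s, ω n ∈ f n} =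
        univ ×ˢ {ω | ∀ m ∈ s, ω m ∈ f m} := by
      ext ⟨t, ω⟩
      simp only [mem_preimage, mem_ofPred_eq, mem_prod, mem_univ, true_and]
      refine forall₂_congr fun m hm => ?_
      rw [Function.update_of_ne (ne_of_mem_of_not_mem hm hn)]
    rw [this, Measure.prod_prod, hP _ _ hf, measure_univ, one_mul]

/-- A set not depending on the `n`-th coordinate, measurable or not, is independent of it. -/
theorem measure_inter_eval_of_update_invariant {μ : Measure ℝ} [IsProbabilityMeasure μ]
    {P : Measure (ℕ → ℝ)} [IsProbabilityMeasure P] {n : ℕ}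
    (hmap : (μ.prod P).map (fun q : ℝ × (ℕ → ℝ) => Function.update q.2 n q.1) = P)
    {S : Set (ℕ → ℝ)} (hS : ∀ ω t, Function.update ω n t ∈ S ↔ ω ∈ S)
    {M : Set ℝ} (hM : MeasurableSet M) :
    P (S ∩ {ω | ω n ∈ M}) = P S * μ M := by
  have hΦ : AEMeasurable (fun q : ℝ × (ℕ → ℝ) => Function.update q.2 n q.1) (μ.prod P) :=
    AEMeasurable.of_map_ne_zero (by rw [hmap]; exact IsProbabilityMeasure.ne_zero P)
  have key : ∀ N : Set ℝ, P S * μ N ≤ P (S ∩ {ω | ω n ∈ N}) := fun N => by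
    have h := Measure.le_map_apply hΦ (S ∩ {ω | ω n ∈ N})
    have e : (fun q : ℝ × (ℕ → ℝ) => Function.update q.2 n q.1) ⁻¹' (S ∩ {ω | ω n ∈ N}) =
        N ×ˢ S := by
      ext ⟨t, ω⟩; simp [hS, and_comm]
    rwa [hmap, e, Measure.prod_prod, mul_comm] at h
  refine le_antisymm ?_ (key M)
  have hsplit := measure_inter_add_sdiff (μ := P) S (measurable_pi_apply n hM)
  have hc := key Mᶜ
  have e : S \ (fun ω : ℕ → ℝ => ω n) ⁻¹' M = S ∩ {ω | ω n ∈ Mᶜ} := rfl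
  rw [e] at hsplit
  have hsum : P S * μ M + P S * μ Mᶜ = P S := by
    rw [← mul_add, measure_add_measure_compl hM, measure_univ, mul_one]
  have hfin : P S * μ Mᶜ ≠ ∞ := ENNReal.mul_ne_top (measure_ne_top _ _) (measure_ne_top _ _)
  refine (ENNReal.add_le_add_iff_right hfin).1 ?_
  calc P (S ∩ {ω | ω n ∈ M}) + P S * μ Mᶜ
      ≤ P (S ∩ {ω | ω n ∈ M}) + P (S ∩ {ω | ω n ∈ Mᶜ}) := by gcongr
    _ = P S * μ M + P S * μ Mᶜ := by rw [hsum]; exact hsplit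

/-- If `E` is unaffected by changing an `n`-th coordinate that lies in `C \ D`, then restricting that
coordinate from `C` to `D` increases the conditional probability of `E`. -/
theorem measure_inter_restrict_coord {μ : Measure ℝ} [IsProbabilityMeasure μ]
    {P : Measure (ℕ → ℝ)} [IsProbabilityMeasure P] {n : ℕ}
    (hmap : (μ.prod P).map (fun q : ℝ × (ℕ → ℝ) => Function.update q.2 n q.1) = P)
    {E W : Set (ℕ → ℝ)} (hW : ∀ ω t, Function.update ω n t ∈ W ↔ ω ∈ W)
    {C D : Set ℝ} (hC : MeasurableSet C) (hD : MeasurableSet D) (hDC : D ⊆ C)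
    (hE : ∀ ω ∈ E, ω n ∈ C \ D → ∀ t, Function.update ω n t ∈ E) :
    P (E ∩ (W ∩ {ω | ω n ∈ C})) * P (W ∩ {ω | ω n ∈ D}) ≤
      P (E ∩ (W ∩ {ω | ω n ∈ D})) * P (W ∩ {ω | ω n ∈ C}) := by
  set S : Set (ℕ → ℝ) := {ω | ω ∈ W ∧ ∃ t ∈ C \ D, Function.update ω n t ∈ E} with hSdef
  have hS : ∀ ω t, Function.update ω n t ∈ S ↔ ω ∈ S := fun ω t => by
    simp [hSdef, hW]
  have hSE : S ⊆ E := by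
    rintro ω ⟨-, t, ht, hω⟩
    simpa using hE _ hω (by simpa using ht) (ω n)
  have hsplit := measure_inter_add_sdiff (μ := P) (E ∩ (W ∩ {ω | ω n ∈ C}))
    (measurable_pi_apply n hD)
  have e1 : (E ∩ (W ∩ {ω | ω n ∈ C})) ∩ (fun ω : ℕ → ℝ => ω n) ⁻¹' D =
      E ∩ (W ∩ {ω | ω n ∈ D}) := by
    ext ω
    have := @hDC (ω n)
    simp only [mem_inter_iff, mem_preimage, mem_ofPred_eq]
    tauto
  have e2 : (E ∩ (W ∩ {ω | ω n ∈ C})) \ (fun ω : ℕ → ℝ => ω n) ⁻¹' D =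
      S ∩ {ω | ω n ∈ C \ D} := by
    ext ω
    constructor
    · rintro ⟨⟨h1, h2, h3⟩, h4⟩
      exact ⟨⟨h2, ω n, ⟨h3, h4⟩, by simpa using h1⟩, h3, h4⟩
    · rintro ⟨h1, h3, h4⟩
      exact ⟨⟨hSE h1, h1.1, h3⟩, h4⟩
  have hle : P S * μ D ≤ P (E ∩ (W ∩ {ω | ω n ∈ D})) := by
    rw [← measure_inter_eval_of_update_invariant hmap hS hD]
    exact measure_mono fun ω h => ⟨hSE h.1, h.1.1, h.2⟩
  rw [e1, e2, measure_inter_eval_of_update_invariant hmap hS (hC.diff hD)] at hsplit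
  rw [← hsplit, measure_inter_eval_of_update_invariant hmap hW hC,
    measure_inter_eval_of_update_invariant hmap hW hD]
  calc (P (E ∩ (W ∩ {ω | ω n ∈ D})) + P S * μ (C \ D)) * (P W * μ D)
      = P (E ∩ (W ∩ {ω | ω n ∈ D})) * (P W * μ D) + (P S * μ D) * (P W * μ (C \ D)) := by ring
    _ ≤ P (E ∩ (W ∩ {ω | ω n ∈ D})) * (P W * μ D) +
        P (E ∩ (W ∩ {ω | ω n ∈ D})) * (P W * μ (C \ D)) := by gcongr
    _ = _ := by
      rw [← mul_add, ← mul_add]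
      rw [measure_add_sdiff hD.nullMeasurableSet C, union_eq_self_of_subset_left hDC]

/-- Restricting every coordinate `n < k` from `C n` to `D n` increases the conditional probability
of `E` when `E` is unaffected by changing any coordinate that lies in `C n \ D n`. -/
theorem measure_inter_restrict_coords {μ : Measure ℝ} [IsProbabilityMeasure μ]
    {P : Measure (ℕ → ℝ)} [IsProbabilityMeasure P]
    (hmap : ∀ n, (μ.prod P).map (fun q : ℝ × (ℕ → ℝ) => Function.update q.2 n q.1) = P)
    {E : Set (ℕ → ℝ)} {C D : ℕ → Set ℝ} (hC : ∀ n, MeasurableSet (C n))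
    (hD : ∀ n, MeasurableSet (D n)) (hDC : ∀ n, D n ⊆ C n)
    (hE : ∀ n, ∀ ω ∈ E, ω n ∈ C n \ D n → ∀ t, Function.update ω n t ∈ E) (k : ℕ) :
    P (E ∩ {ω | ∀ n < k, ω n ∈ C n}) * P {ω | ∀ n < k, ω n ∈ D n} ≤
      P (E ∩ {ω | ∀ n < k, ω n ∈ D n}) * P {ω | ∀ n < k, ω n ∈ C n} := by
  set Q : ℕ → Set (ℕ → ℝ) := fun j => {ω | ∀ n < k, ω n ∈ if n < j then D n else C n} with hQ
  have hQ0 : {ω : ℕ → ℝ | ∀ n < k, ω n ∈ C n} = Q 0 := by simp [hQ]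
  have hQk : {ω : ℕ → ℝ | ∀ n < k, ω n ∈ D n} = Q k := by
    ext ω
    exact forall₂_congr fun n hn => by rw [if_pos hn]
  have step : ∀ j < k, P (E ∩ Q j) * P (Q (j + 1)) ≤ P (E ∩ Q (j + 1)) * P (Q j) := by
    intro j hj
    set W : Set (ℕ → ℝ) := {ω | ∀ n < k, n ≠ j → ω n ∈ if n < j then D n else C n} with hWdef
    have hW : ∀ ω t, Function.update ω j t ∈ W ↔ ω ∈ W := fun ω t =>
      forall₃_congr fun n _ hne => by rw [Function.update_of_ne hne]
    have e1 : Q j = W ∩ {ω | ω j ∈ C j} := by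
      ext ω
      refine ⟨fun h => ⟨fun n hn _ => h n hn, by simpa using h j hj⟩, fun h n hn => ?_⟩
      by_cases e : n = j
      · subst e; simpa using h.2
      · exact h.1 n hn e
    have e2 : Q (j + 1) = W ∩ {ω | ω j ∈ D j} := by
      ext ω
      have hif : ∀ n, n ≠ j →
          (if n < j + 1 then D n else C n) = if n < j then D n else C n := fun n hn => by
        congr 1; simp only [eq_iff_iff]; omega
      refine ⟨fun h => ⟨fun n hn e => hif n e ▸ h n hn, by simpa using h j hj⟩, fun h n hn => ?_⟩
      by_cases e : n = j
      · subst e; simpa using h.2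
      · rw [hif n e]; exact h.1 n hn e
    rw [e1, e2]
    exact measure_inter_restrict_coord (hmap j) hW (hC j) (hD j) (hDC j) (hE j)
  have chain : ∀ j ≤ k, P (E ∩ Q 0) * P (Q j) ≤ P (E ∩ Q j) * P (Q 0) := by
    intro j
    induction j with
    | zero => exact fun _ => le_rfl
    | succ j ih =>
      intro hj
      have hmono : P (Q (j + 1)) ≤ P (Q j) := by
        refine measure_mono fun ω h n hn => ?_
        have := h n hn
        by_cases h1 : n < j
        · simpa [h1, Nat.lt_succ_of_lt h1] using this
        · rw [if_neg h1]
          split_ifs at this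
          exacts [hDC n this, this]
      rcases eq_or_ne (P (Q j)) 0 with h0 | h0
      · have : P (Q (j + 1)) = 0 := le_antisymm (hmono.trans h0.le) zero_le
        simp [this]
      refine (ENNReal.mul_le_mul_iff_left h0 (measure_ne_top _ _)).1 ?_
      calc P (E ∩ Q 0) * P (Q (j + 1)) * P (Q j)
          = P (E ∩ Q 0) * P (Q j) * P (Q (j + 1)) := by ring
        _ ≤ P (E ∩ Q j) * P (Q 0) * P (Q (j + 1)) := mul_le_mul_left (ih (by omega)) _
        _ = P (E ∩ Q j) * P (Q (j + 1)) * P (Q 0) := by ring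
        _ ≤ P (E ∩ Q (j + 1)) * P (Q j) * P (Q 0) := mul_le_mul_left (step j hj) _
        _ = P (E ∩ Q (j + 1)) * P (Q 0) * P (Q j) := by ring
  rw [hQ0, hQk]
  exact chain k le_rfl

/-- If no ball covering `q` but not `p` meets `A`, then, given that `p` is uncovered, covering `A`
increases the conditional probability that `q` is uncovered. -/
theorem cond_uncovered_le_of_disjoint {μ : Measure ℝ} [IsProbabilityMeasure μ]
    {P : Measure (ℕ → ℝ)}
    (hP : ∀ (s : Finset ℕ) (f : ℕ → Set ℝ), (∀ n, MeasurableSet (f n)) →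
      P {ω | ∀ n ∈ s, ω n ∈ f n} = ∏ n ∈ s, μ (f n))
    {r : ℕ → ℝ} (k : ℕ) {p q : ℝ} {A : Set ℝ}
    (hA : ∀ n z, p ∉ ball z (r n) → q ∈ ball z (r n) → Disjoint (ball z (r n)) A)
    (hEp : 0 < P {ω | A ⊆ Uk r k ω ∧ p ∉ Uk r k ω}) (hp : 0 < P {ω | p ∉ Uk r k ω}) :
    P {ω | q ∉ Uk r k ω ∧ p ∉ Uk r k ω} / P {ω | p ∉ Uk r k ω} ≤
      P {ω | q ∉ Uk r k ω ∧ (A ⊆ Uk r k ω ∧ p ∉ Uk r k ω)} /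
        P {ω | A ⊆ Uk r k ω ∧ p ∉ Uk r k ω} := by
  have : IsProbabilityMeasure P := ⟨by simpa using hP ∅ (fun _ => univ) fun _ => .univ⟩
  have hmeas : ∀ n (a : ℝ), MeasurableSet {z | a ∉ ball z (r n)} := fun n a => by
    simp_rw [mem_ball_comm (x := a)]
    exact measurableSet_ball.compl
  have hU : ∀ ω (a : ℝ), a ∉ Uk r k ω ↔ ∀ n < k, a ∉ ball (ω n) (r n) := fun ω a => by
    simp [Uk]
  have key := measure_inter_restrict_coords (P := P) (map_update_prod hP)
    (E := {ω | A ⊆ Uk r k ω}) (C := fun n => {z | p ∉ ball z (r n)})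
    (D := fun n => {z | p ∉ ball z (r n)} ∩ {z | q ∉ ball z (r n)})
    (fun n => hmeas n p) (fun n => (hmeas n p).inter (hmeas n q)) (fun n => inter_subset_left)
    (by
      rintro n ω hω ⟨h1, h2⟩ t a ha
      have hq : q ∈ ball (ω n) (r n) := by
        by_contra h
        exact h2 ⟨h1, h⟩
      obtain ⟨m, hm, ham⟩ := mem_iUnion₂.1 (hω ha)
      have hne : m ≠ n := by
        rintro rfl
        exact disjoint_left.1 (hA m _ h1 hq) ham ha
      exact mem_iUnion₂.2 ⟨m, hm, by rwa [Function.update_of_ne hne]⟩) k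
  have e1 : {ω : ℕ → ℝ | ∀ n < k, ω n ∈ {z | p ∉ ball z (r n)}} = {ω | p ∉ Uk r k ω} := by
    ext ω; exact (hU ω p).symm
  have e2 : {ω : ℕ → ℝ | ∀ n < k, ω n ∈ {z | p ∉ ball z (r n)} ∩ {z | q ∉ ball z (r n)}} =
      {ω | q ∉ Uk r k ω ∧ p ∉ Uk r k ω} := by
    ext ω
    simp only [mem_ofPred_eq, hU]
    exact ⟨fun h => ⟨fun n hn => (h n hn).2, fun n hn => (h n hn).1⟩,
      fun h n hn => ⟨h.2 n hn, h.1 n hn⟩⟩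
  have e3 : {ω | A ⊆ Uk r k ω} ∩ {ω | q ∉ Uk r k ω ∧ p ∉ Uk r k ω} =
      {ω | q ∉ Uk r k ω ∧ (A ⊆ Uk r k ω ∧ p ∉ Uk r k ω)} := by
    ext ω; exact and_left_comm
  rw [e1, e2, e3, ← ofPred_and] at key
  rw [ENNReal.div_le_iff hp.ne' (measure_ne_top _ _), ← ENNReal.mul_div_right_comm,
    ENNReal.le_div_iff_mul_le (Or.inl hEp.ne') (Or.inl (measure_ne_top _ _)), mul_comm]
  exact key

/-- The crux lemma: conditioning on covering a set `A` lying entirely to the left of `x`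
(resp. right of `y`) while leaving `x` (resp. `y`) uncovered only increases the conditional
probability that the point on the other side is uncovered. -/
theorem crux_lemma
    (μ : Measure ℝ) [IsProbabilityMeasure μ]
    (P : Measure (ℕ → ℝ))
    (hP : ∀ (s : Finset ℕ) (f : ℕ → Set ℝ), (∀ n, MeasurableSet (f n)) →
      P {ω | ∀ n ∈ s, ω n ∈ f n} = ∏ n ∈ s, μ (f n))
    (r : ℕ → ℝ) (hpos : ∀ n, 0 < r n)
    (k : ℕ) (x y : ℝ) (hxy : x < y)
    (A : Set ℝ) (hAmeas : NullMeasurableSet A μ) :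
    (A ⊆ Iio x →
      0 < P {ω | A ⊆ Uk r k ω ∧ x ∉ Uk r k ω} →
      0 < P {ω | x ∉ Uk r k ω} →
      P {ω | y ∉ Uk r k ω ∧ x ∉ Uk r k ω} / P {ω | x ∉ Uk r k ω} ≤
        P {ω | y ∉ Uk r k ω ∧ (A ⊆ Uk r k ω ∧ x ∉ Uk r k ω)} /
          P {ω | A ⊆ Uk r k ω ∧ x ∉ Uk r k ω}) ∧
    (A ⊆ Ioi y →
      0 < P {ω | A ⊆ Uk r k ω ∧ y ∉ Uk r k ω} →
      0 < P {ω | y ∉ Uk r k ω} →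
      P {ω | x ∉ Uk r k ω ∧ y ∉ Uk r k ω} / P {ω | y ∉ Uk r k ω} ≤
        P {ω | x ∉ Uk r k ω ∧ (A ⊆ Uk r k ω ∧ y ∉ Uk r k ω)} /
          P {ω | A ⊆ Uk r k ω ∧ y ∉ Uk r k ω}) := by
  refine ⟨fun hA => cond_uncovered_le_of_disjoint hP k fun n z hx hy => ?_,
    fun hA => cond_uncovered_le_of_disjoint hP k fun n z hy hx => ?_⟩
  all_goals
    refine disjoint_left.2 fun a ha haA => ?_
    have haA := hA haA
    rw [Real.ball_eq_Ioo] at *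
    simp only [mem_Ioo, mem_Iio, mem_Ioi, not_and, not_lt] at *
  · linarith [hx (by linarith)]
  · by_cases h : z - r n < y
    · linarith [hy h]
    · linarith

end
end

section
/- Let μ be a Borel probability measure on ℝ^d, let r = (r_n)_{n≥1} be a non-increasing sequence of positive real numbers tending to zero, let ε > 0, let 0 < c < 1, and let C ⊆ ℝ^d ∖ X_atom be a compact set such that ∑_{k=1}^∞ μ(B(x, c·r_k))^{1+ε} = ∞ for every x ∈ C. Then ℙ_μ({ω : C ⊆ limsup_{k→∞} B(ω_k, r_k)}) = 1. -/
open MeasureTheory Metric Filter Set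
open scoped ENNReal Topology

noncomputable section

variable {d : ℕ}

/-- The atoms of `μ` inside its support. -/
def Xatom (μ : Measure (EuclideanSpace ℝ (Fin d))) : Set (EuclideanSpace ℝ (Fin d)) :=
  {x ∈ msupport μ | 0 < μ {x}}

/-- If every ball of radius `c * ρ` centred in `G` has mass at least `a`, then `G` is within
distance `δ * ρ` of `O(1 / a)` of its points, uniformly in `ρ`. -/
lemma exists_finset_net (c δ : ℝ) (hc : 0 < c) (hδ : 0 < δ) :
    ∃ K : ℕ, ∀ (μ : Measure (EuclideanSpace ℝ (Fin d))) [IsProbabilityMeasure μ]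
      (G : Set (EuclideanSpace ℝ (Fin d))) (ρ a : ℝ), 0 < ρ → 0 < a →
      (∀ x ∈ G, ENNReal.ofReal a ≤ μ (ball x (c * ρ))) →
      ∃ t : Finset (EuclideanSpace ℝ (Fin d)), ↑t ⊆ G ∧
        (∀ x ∈ G, ∃ y ∈ t, dist x y < δ * ρ) ∧ (t.card : ℝ) * a ≤ K := by
  classical
  obtain ⟨T, -, hTfin, hT⟩ := finite_cover_balls_of_compact
    (isCompact_closedBall (0 : EuclideanSpace ℝ (Fin d)) (2 * c)) (half_pos hδ)
  lift T to Finset (EuclideanSpace ℝ (Fin d)) using hTfin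
  refine ⟨T.card, fun μ _ G ρ a hρ ha hG => ?_⟩
  obtain ⟨u, huG, hdisj, hu⟩ := Vitali.exists_disjoint_subfamily_covering_enlargement
    (fun x : EuclideanSpace ℝ (Fin d) => ball x (c * ρ)) G (fun _ => 1) 2 (by norm_num)
    (fun _ _ => zero_le_one) 1 (fun _ _ => le_rfl)
    (fun x _ => ⟨x, mem_ball_self (by positivity)⟩)
  have hcard : ∀ s : Finset (EuclideanSpace ℝ (Fin d)), ↑s ⊆ u → (s.card : ℝ) * a ≤ 1 := by
    intro s hs
    have h1 : ∑ x ∈ s, μ (ball x (c * ρ)) ≤ μ univ :=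
      sum_measure_le_measure_univ (fun x _ => measurableSet_ball.nullMeasurableSet)
        (fun x hx y hy hxy => (hdisj (hs hx) (hs hy) hxy).aedisjoint)
    have h2 : (s.card : ℝ≥0∞) * ENNReal.ofReal a ≤ 1 := by
      rw [measure_univ] at h1
      refine le_trans ?_ h1
      rw [← nsmul_eq_mul]
      exact Finset.card_nsmul_le_sum _ _ _ fun x hx => hG x (huG (hs hx))
    rw [← ENNReal.ofReal_natCast, ← ENNReal.ofReal_mul (by positivity)] at h2
    exact ENNReal.ofReal_le_one.mp h2
  have hufin : u.Finite := by
    by_contra hinf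
    obtain ⟨n, hn⟩ := exists_nat_gt (1 / a)
    obtain ⟨s, hs, rfl⟩ := Set.Infinite.exists_subset_card_eq hinf n
    have := hcard s hs
    rw [div_lt_iff₀ ha] at hn
    linarith
  lift u to Finset (EuclideanSpace ℝ (Fin d)) using hufin
  let Q : EuclideanSpace ℝ (Fin d) × EuclideanSpace ℝ (Fin d) → Prop :=
    fun p => ∃ x ∈ G, dist x (p.1 + ρ • p.2) < δ / 2 * ρ
  let f : EuclideanSpace ℝ (Fin d) × EuclideanSpace ℝ (Fin d) → EuclideanSpace ℝ (Fin d) :=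
    fun p => if h : Q p then h.choose else 0
  have hf : ∀ p, Q p → f p ∈ G ∧ dist (f p) (p.1 + ρ • p.2) < δ / 2 * ρ := by
    intro p hp
    simp only [f, dif_pos hp]
    exact hp.choose_spec
  refine ⟨((u ×ˢ T).filter Q).image f, ?_, fun x hx => ?_, ?_⟩
  · intro y hy
    simp only [Finset.coe_image, mem_image, Finset.mem_coe, Finset.mem_filter] at hy
    obtain ⟨p, ⟨-, hp⟩, rfl⟩ := hy
    exact (hf p hp).1
  · obtain ⟨y, hyu, ⟨w, hwx, hwy⟩, -⟩ := hu x hx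
    have hxy : dist x y ≤ 2 * c * ρ := by
      have := dist_triangle_left x y w
      rw [mem_ball] at hwx hwy
      linarith
    have hmem : ρ⁻¹ • (x - y) ∈ closedBall (0 : EuclideanSpace ℝ (Fin d)) (2 * c) := by
      rw [mem_closedBall, dist_zero_right, norm_smul, Real.norm_eq_abs,
        abs_of_pos (inv_pos.mpr hρ), ← dist_eq_norm, inv_mul_le_iff₀ hρ]
      linarith
    obtain ⟨z, hzT, hz⟩ := mem_iUnion₂.mp (hT hmem)
    have hxz : dist x (y + ρ • z) < δ / 2 * ρ := by
      rw [mem_ball, dist_eq_norm] at hz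
      have : x - (y + ρ • z) = ρ • (ρ⁻¹ • (x - y) - z) := by
        rw [smul_sub, smul_inv_smul₀ hρ.ne']
        abel
      rw [dist_eq_norm, this, norm_smul, Real.norm_eq_abs, abs_of_pos hρ, mul_comm]
      gcongr
    have hQ : Q (y, z) := ⟨x, hx, hxz⟩
    refine ⟨f (y, z), Finset.mem_image_of_mem _ (Finset.mem_filter.mpr
      ⟨Finset.mem_product.mpr ⟨hyu, hzT⟩, hQ⟩), ?_⟩
    have := dist_triangle_right x (f (y, z)) (y + ρ • z)
    have := (hf _ hQ).2
    dsimp only at this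
    linarith
  · have h1 : ((((u ×ˢ T).filter Q).image f).card : ℝ) ≤ u.card * T.card := by
      rw [← Nat.cast_mul, ← Finset.card_product]
      exact_mod_cast Finset.card_image_le.trans (Finset.card_filter_le _ _)
    calc _ ≤ (u.card * T.card : ℝ) * a := by gcongr
      _ = u.card * a * T.card := by ring
      _ ≤ 1 * T.card := by gcongr; exact hcard u subset_rfl
      _ = T.card := one_mul _

lemma frequently_rpow_neg_le_of_tsum_rpow_eq_top (a : ℕ → ℝ≥0∞) (ha : ∀ k, a k ≤ 1) (p s : ℝ)
    (hp : 0 < p) (hsp : 1 < s * p) (h : ∑' k, a k ^ p = ∞) :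
    ∃ᶠ k : ℕ in atTop, ENNReal.ofReal (((k : ℝ) + 1) ^ (-s)) ≤ a k := by
  intro hev
  have hfin : ∀ k, a k ^ p ≠ ∞ := fun k =>
    ENNReal.rpow_ne_top_of_nonneg hp.le ((ha k).trans_lt ENNReal.one_lt_top).ne
  have hsum : Summable fun k : ℕ => ((k : ℝ) + 1) ^ (-(s * p)) := by
    have := (summable_nat_add_iff 1).mpr (Real.summable_nat_rpow.mpr (neg_lt_neg hsp))
    simpa using this
  have hsum' : Summable fun k => (a k ^ p).toReal := by
    refine summable_of_isBigO_nat hsum (Asymptotics.IsBigO.of_bound 1 ?_)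
    filter_upwards [hev] with k hk
    rw [not_le] at hk
    have hk0 : (0 : ℝ) ≤ (k : ℝ) + 1 := by positivity
    rw [one_mul, Real.norm_of_nonneg ENNReal.toReal_nonneg, Real.norm_of_nonneg (by positivity)]
    refine ENNReal.toReal_le_of_le_ofReal (by positivity) ?_
    calc a k ^ p ≤ ENNReal.ofReal (((k : ℝ) + 1) ^ (-s)) ^ p :=
          ENNReal.rpow_le_rpow hk.le hp.le
      _ = ENNReal.ofReal (((k : ℝ) + 1) ^ (-(s * p))) := by
          rw [ENNReal.ofReal_rpow_of_nonneg (by positivity) hp.le, ← Real.rpow_mul hk0, neg_mul]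
  refine hsum'.tsum_ofReal_ne_top ?_
  simp_rw [ENNReal.ofReal_toReal (hfin _)]
  exact h

lemma summable_mul_exp_neg_rpow (A t : ℝ) (ht : 0 < t) :
    Summable fun k : ℕ => A * ((k : ℝ) + 1) * Real.exp (-((k : ℝ) + 1) ^ t) := by
  have hsum : Summable fun k : ℕ => ((k : ℝ) + 1) ^ (-2 : ℝ) := by
    have := (summable_nat_add_iff 1).mpr
      (Real.summable_nat_rpow.mpr (show (-2 : ℝ) < -1 by norm_num))
    simpa using this
  have htop : Tendsto (fun k : ℕ => ((k : ℝ) + 1) ^ t) atTop atTop :=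
    (tendsto_rpow_atTop ht).comp
      (tendsto_atTop_add_const_right _ _ tendsto_natCast_atTop_atTop)
  have hexp := ((isLittleO_exp_neg_mul_rpow_atTop one_pos (-3 / t)).comp_tendsto htop).isBigO
  refine summable_of_isBigO_nat hsum ?_
  have := (Asymptotics.isBigO_refl (fun k : ℕ => A * ((k : ℝ) + 1)) atTop).mul hexp
  refine (this.congr_left fun k => by simp).trans (Asymptotics.IsBigO.of_bound |A| ?_)
  refine Eventually.of_forall fun k => le_of_eq ?_
  have hk : (0 : ℝ) < (k : ℝ) + 1 := by positivity
  have h1 : ((k : ℝ) + 1) * (((k : ℝ) + 1) ^ t) ^ (-3 / t) = ((k : ℝ) + 1) ^ (-2 : ℝ) := by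
    rw [← Real.rpow_mul hk.le, mul_div_cancel₀ _ ht.ne']
    nth_rewrite 1 [← Real.rpow_one ((k : ℝ) + 1)]
    rw [← Real.rpow_add hk]
    norm_num
  simp only [Function.comp_apply]
  rw [mul_assoc, h1, norm_mul, Real.norm_eq_abs A]

/-- The probability that none of the `n` independent points indexed by `s` hits its target,
when every target has mass at least `b`. -/
lemma measure_forall_notMem_le {E : Type*} [MeasurableSpace E]
    (μ : Measure E) [IsProbabilityMeasure μ] (P : Measure (ℕ → E))
    (hP : ∀ (s : Finset ℕ) (f : ℕ → Set E), (∀ n, MeasurableSet (f n)) →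
      P {ω | ∀ n ∈ s, ω n ∈ f n} = ∏ n ∈ s, μ (f n))
    (s : Finset ℕ) (B : ℕ → Set E) (hB : ∀ n, MeasurableSet (B n)) (b : ℝ) (hb : 0 ≤ b)
    (h : ∀ n ∈ s, ENNReal.ofReal b ≤ μ (B n)) :
    P {ω | ∀ n ∈ s, ω n ∉ B n} ≤ ENNReal.ofReal (Real.exp (-(s.card * b))) := by
  have h1 := hP s (fun n => (B n)ᶜ) fun n => (hB n).compl
  simp only [mem_compl_iff] at h1
  rw [h1]
  calc ∏ n ∈ s, μ (B n)ᶜ ≤ ∏ _n ∈ s, ENNReal.ofReal (Real.exp (-b)) := by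
        refine Finset.prod_le_prod' fun n hn => ?_
        rw [prob_compl_eq_one_sub (hB n)]
        calc 1 - μ (B n) ≤ 1 - ENNReal.ofReal b := tsub_le_tsub_left (h n hn) _
          _ = ENNReal.ofReal (1 - b) := by rw [ENNReal.ofReal_sub _ hb, ENNReal.ofReal_one]
          _ ≤ _ := ENNReal.ofReal_le_ofReal (Real.one_sub_le_exp_neg b)
    _ = _ := by
        rw [Finset.prod_const, ← ENNReal.ofReal_pow (Real.exp_pos _).le, ← Real.exp_nat_mul,
          mul_neg]

/-- Almost surely, every point of `C` is covered by a ball of index at least `m`. -/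
lemma measure_exists_uncovered_eq_zero
    (μ : Measure (EuclideanSpace ℝ (Fin d))) [IsProbabilityMeasure μ]
    (P : Measure (ℕ → EuclideanSpace ℝ (Fin d)))
    (hP : ∀ (s : Finset ℕ) (f : ℕ → Set (EuclideanSpace ℝ (Fin d))),
      (∀ n, MeasurableSet (f n)) →
      P {ω | ∀ n ∈ s, ω n ∈ f n} = ∏ n ∈ s, μ (f n))
    (r : ℕ → ℝ) (hmono : Antitone r) (hpos : ∀ n, 0 < r n)
    (ε : ℝ) (hε : 0 < ε) (c : ℝ) (hc0 : 0 < c) (hc1 : c < 1)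
    (C : Set (EuclideanSpace ℝ (Fin d)))
    (hdiv : ∀ x ∈ C, (∑' k, μ (ball x (c * r k)) ^ (1 + ε : ℝ)) = ∞) (m : ℕ) :
    P {ω | ∃ x ∈ C, ∀ n, m ≤ n → x ∉ ball (ω n) (r n)} = 0 := by
  obtain ⟨s, hs1, hs2⟩ : ∃ s : ℝ, 1 / (1 + ε) < s ∧ s < 1 :=
    exists_between (by rw [div_lt_one (by positivity)]; linarith)
  have hsp : 1 < s * (1 + ε) := by rwa [div_lt_iff₀ (by positivity)] at hs1
  have hs0 : 0 < s := lt_trans (by positivity) hs1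
  set b : ℕ → ℝ := fun k => ((k : ℝ) + 1) ^ (-s) with hbdef
  have hb0 : ∀ k, 0 < b k := fun k => by positivity
  have hb1 : ∀ k, b k ≤ 1 := fun k =>
    Real.rpow_le_one_of_one_le_of_nonpos (by simp) (by linarith)
  let G : ℕ → Set (EuclideanSpace ℝ (Fin d)) :=
    fun k => {x | ENNReal.ofReal (b k) ≤ μ (ball x (c * r k))}
  let bad : ℕ → Set (ℕ → EuclideanSpace ℝ (Fin d)) :=
    fun k => {ω | ∃ x ∈ G k, ∀ n ∈ Finset.Icc m k, x ∉ ball (ω n) (r n)}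
  obtain ⟨K, hK⟩ := exists_finset_net (d := d) c (1 - c) hc0 (by linarith)
  have hbad : ∀ k, P (bad k) ≤ ENNReal.ofReal
      (K * Real.exp m * ((k : ℝ) + 1) * Real.exp (-((k : ℝ) + 1) ^ (1 - s))) := by
    intro k
    obtain ⟨t, htG, ht, htcard⟩ := hK μ (G k) (r k) (b k) (hpos k) (hb0 k) fun x hx => hx
    have hsub : bad k ⊆ ⋃ y ∈ t, {ω | ∀ n ∈ Finset.Icc m k, ω n ∉ ball y (c * r n)} := by
      rintro ω ⟨x, hx, hω⟩
      obtain ⟨y, hyt, hxy⟩ := ht x hx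
      refine mem_iUnion₂.mpr ⟨y, hyt, fun n hn hmem => hω n hn ?_⟩
      have hrn := hmono (Finset.mem_Icc.mp hn).2
      rw [mem_ball] at hmem ⊢
      have := dist_triangle_right x (ω n) y
      have : (1 - c) * r k ≤ (1 - c) * r n :=
        mul_le_mul_of_nonneg_left hrn (by linarith)
      linarith
    have hk : (0 : ℝ) < (k : ℝ) + 1 := by positivity
    have hmul : ((k : ℝ) + 1) * b k = ((k : ℝ) + 1) ^ (1 - s) := by
      simp only [hbdef]
      nth_rewrite 1 [← Real.rpow_one ((k : ℝ) + 1)]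
      rw [← Real.rpow_add hk, sub_eq_add_neg]
    have hexp : Real.exp (-((Finset.Icc m k).card * b k)) ≤
        Real.exp m * Real.exp (-((k : ℝ) + 1) ^ (1 - s)) := by
      rw [← Real.exp_add, Real.exp_le_exp, ← hmul]
      have h1 : (k : ℝ) + 1 ≤ (Finset.Icc m k).card + m := by
        rw [Nat.card_Icc]
        norm_cast
        omega
      have h2 : (m : ℝ) * b k ≤ m := mul_le_of_le_one_right (by positivity) (hb1 k)
      nlinarith [mul_le_mul_of_nonneg_right h1 (hb0 k).le]
    have hcard : (t.card : ℝ) ≤ K * ((k : ℝ) + 1) := by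
      have h1 : 1 ≤ ((k : ℝ) + 1) * b k := by
        rw [hmul]
        exact Real.one_le_rpow (by simp) (by linarith)
      calc (t.card : ℝ) ≤ t.card * (((k : ℝ) + 1) * b k) :=
            le_mul_of_one_le_right (by positivity) h1
        _ = t.card * b k * ((k : ℝ) + 1) := by ring
        _ ≤ K * ((k : ℝ) + 1) := by gcongr
    calc P (bad k) ≤ ∑ y ∈ t, P {ω | ∀ n ∈ Finset.Icc m k, ω n ∉ ball y (c * r n)} :=
          (measure_mono hsub).trans (measure_biUnion_finset_le _ _)
      _ ≤ ∑ _y ∈ t, ENNReal.ofReal (Real.exp (-((Finset.Icc m k).card * b k))) := by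
          refine Finset.sum_le_sum fun y hy => measure_forall_notMem_le μ P hP _ _
            (fun _ => measurableSet_ball) _ (hb0 k).le fun n hn => (htG hy).trans ?_
          refine measure_mono (ball_subset_ball ?_)
          exact mul_le_mul_of_nonneg_left (hmono (Finset.mem_Icc.mp hn).2) hc0.le
      _ = ENNReal.ofReal (t.card * Real.exp (-((Finset.Icc m k).card * b k))) := by
          rw [Finset.sum_const, nsmul_eq_mul, ENNReal.ofReal_mul (by positivity),
            ENNReal.ofReal_natCast]
      _ ≤ _ := by
          refine ENNReal.ofReal_le_ofReal ?_
          calc _ ≤ K * ((k : ℝ) + 1) * (Real.exp m * Real.exp (-((k : ℝ) + 1) ^ (1 - s))) := by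
                gcongr
            _ = _ := by ring
  refine measure_mono_null ?_ (measure_limsup_atTop_eq_zero (s := bad) (ne_top_of_le_ne_top
    (summable_mul_exp_neg_rpow (K * Real.exp m) (1 - s) (by linarith)).tsum_ofReal_ne_top
    (ENNReal.tsum_le_tsum hbad)))
  rintro ω ⟨x, hxC, hx⟩
  rw [mem_limsup_iff_frequently_mem]
  exact (frequently_rpow_neg_le_of_tsum_rpow_eq_top _ (fun _ => prob_le_one) _ s (by linarith)
    hsp (hdiv x hxC)).mono fun k hk => ⟨x, hk, fun n hn => hx n (Finset.mem_Icc.mp hn).1⟩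

/-- A compact set `C ⊆ ℝ^d ∖ X_atom` on which `∑_k μ(B(x, c·r_k))^{1+ε} = ∞` for some
`0 < c < 1` is `ℙ_μ`-almost surely covered by `limsup_k B(ω_k, r_k)`. -/
theorem compact_covered_of_one_plus_eps_divergence_shrunk
    (μ : Measure (EuclideanSpace ℝ (Fin d))) [IsProbabilityMeasure μ]
    (P : Measure (ℕ → EuclideanSpace ℝ (Fin d)))
    (hP : ∀ (s : Finset ℕ) (f : ℕ → Set (EuclideanSpace ℝ (Fin d))),
      (∀ n, MeasurableSet (f n)) →
      P {ω | ∀ n ∈ s, ω n ∈ f n} = ∏ n ∈ s, μ (f n))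
    (r : ℕ → ℝ) (hmono : Antitone r) (hpos : ∀ n, 0 < r n)
    (hlim : Tendsto r atTop (𝓝 0))
    (ε : ℝ) (hε : 0 < ε) (c : ℝ) (hc0 : 0 < c) (hc1 : c < 1)
    (C : Set (EuclideanSpace ℝ (Fin d))) (hCc : IsCompact C)
    (hCX : C ⊆ (Xatom μ)ᶜ)
    (hdiv : ∀ x ∈ C, (∑' k, μ (ball x (c * r k)) ^ (1 + ε : ℝ)) = ∞) :
    P {ω | C ⊆ coverSet r ω} = 1 := by
  have huniv : P univ = 1 := by simpa using hP ∅ (fun _ => univ) fun _ => MeasurableSet.univ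
  have hnull : P {ω | C ⊆ coverSet r ω}ᶜ = 0 := by
    refine measure_mono_null ?_ (measure_iUnion_null fun m =>
      measure_exists_uncovered_eq_zero μ P hP r hmono hpos ε hε c hc0 hc1 C hdiv m)
    intro ω hω
    obtain ⟨x, hxC, hx⟩ := not_subset.mp hω
    simp only [coverSet, mem_iInter, mem_iUnion, not_forall, not_exists] at hx
    obtain ⟨m, hm⟩ := hx
    exact mem_iUnion.mpr ⟨m, x, hxC, hm⟩
  rw [← huniv]
  exact measure_of_measure_compl_eq_zero hnull

end
end
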